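/- Let G be a Borel graph on a standard Borel space X all of whose vertices have degree at most d, where d ≥ 3 is a natural number, and suppose G contains no complete subgraph on d+1 vertices (i.e. no d+1 pairwise adjacent vertices). Then for every Polish topology τ on X compatible with its Borel structure, G admits a Baire measurable (with respect to τ) proper d-coloring, i.e. a Baire measurable map c : X → {0,…,d−1} with c(x) ≠ c(y) whenever x and y are adjacent. -/

import Mathlib

open MeasureTheory

/-- A partial function `f : B → X` is *one-ended* if there is no infinite sequence
`x₀, x₁, x₂, …` of points of `B` with `f (x_{i+1}) = x_i` for all `i`. -/
def OneEnded {X : Type*} {B : Set X} (f : B → X) : Prop :=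
  ¬ ∃ u : ℕ → B, ∀ i : ℕ, f (u (i + 1)) = (u i : X)

/-- A set of vertices is `G`-invariant if it is a union of connected components of `G`. -/
def GraphInvariant {X : Type*} (G : SimpleGraph X) (A : Set X) : Prop :=
  ∀ ⦃x y : X⦄, G.Reachable x y → x ∈ A → y ∈ A

/-- `[A]_{E_G}`: the union of all connected components of `G` meeting `A`. -/
def EGSat {X : Type*} (G : SimpleGraph X) (A : Set X) : Set X :=
  {x | ∃ a ∈ A, G.Reachable x a}

/-- `S` is biconnected: the induced subgraph on `S` is connected and remains connected
(in the sense of `Preconnected`) after deleting any single vertex of `S`. -/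
def BiconnectedSet {X : Type*} (G : SimpleGraph X) (S : Set X) : Prop :=
  (G.induce S).Connected ∧ ∀ x ∈ S, (G.induce (S \ {x})).Preconnected

/-- A block of `G` is a maximal biconnected set. -/
def GraphBlock {X : Type*} (G : SimpleGraph X) (S : Set X) : Prop :=
  BiconnectedSet G S ∧ ∀ T : Set X, BiconnectedSet G T → S ⊆ T → T = S

/-- The induced subgraph on `S` is a cycle of odd length. -/
def OddCycleSet {X : Type*} (G : SimpleGraph X) (S : Set X) : Prop :=
  ∃ n : ℕ, Odd n ∧ 3 ≤ n ∧ Nonempty (G.induce S ≃g SimpleGraph.cycleGraph n)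

/-- A Gallai tree is a connected graph each of whose blocks induces a complete
graph or an odd cycle. -/
def GallaiTree {X : Type*} (G : SimpleGraph X) : Prop :=
  G.Connected ∧ ∀ S : Set X, GraphBlock G S → G.IsClique S ∨ OddCycleSet G S

/-- A graph is ample if every vertex has degree at least 2 and for every vertex `x`,
every connected component of the restriction of `G` to the complement of `{x}`
contains a vertex of degree at least 3 in that restriction. -/
def AmpleGraph {X : Type*} (G : SimpleGraph X) : Prop :=
  (∀ x : X, 2 ≤ (G.neighborSet x).encard) ∧
  ∀ x : X, ∀ y : ({x}ᶜ : Set X), ∃ z : ({x}ᶜ : Set X),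
    (G.induce ({x}ᶜ : Set X)).Reachable y z ∧
      3 ≤ ((G.induce ({x}ᶜ : Set X)).neighborSet z).encard

/-- `x E^even_G y`: `x` and `y` are joined by a path of even length in `G`. -/
def EvenRel {X : Type*} (G : SimpleGraph X) (x y : X) : Prop :=
  ∃ p : G.Walk x y, p.IsPath ∧ Even p.length

/-- A set is `E^even_G`-invariant if it is a union of `E^even_G`-classes. -/
def EvenInvariant {X : Type*} (G : SimpleGraph X) (C : Set X) : Prop :=
  ∀ ⦃x y : X⦄, EvenRel G x y → x ∈ C → y ∈ C

namespace BaireBrooks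

/-- `x` and `y` are joined by a walk of `G` staying inside `S`. -/
def Joined {X : Type*} (G : SimpleGraph X) (S : Set X) : X → X → Prop :=
  Relation.ReflTransGen fun a b => G.Adj a b ∧ a ∈ S ∧ b ∈ S

/-- `S` is connected (possibly empty). -/
def Conn {X : Type*} (G : SimpleGraph X) (S : Set X) : Prop :=
  ∀ x ∈ S, ∀ y ∈ S, Joined G S x y

/-- `S` is connected and has no cut vertex. -/
def Bicon {X : Type*} (G : SimpleGraph X) (S : Set X) : Prop :=
  Conn G S ∧ ∀ z ∈ S, Conn G (S \ {z})

/-- The number of neighbors of `v` in `S`. -/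
noncomputable def dg {X : Type*} (G : SimpleGraph X) (S : Set X) (v : X) : ℕ :=
  (G.neighborSet v ∩ S).ncard

section Connectivity

variable {X : Type*} {G : SimpleGraph X} {S T R K : Set X} {a b c v w x y z q : X}

lemma Joined.refl : Joined G S x x := Relation.ReflTransGen.refl

lemma Joined.symm (h : Joined G S x y) : Joined G S y x := by
  induction h with
  | refl => exact Relation.ReflTransGen.refl
  | tail _ h ih => exact Relation.ReflTransGen.head ⟨h.1.symm, h.2.2, h.2.1⟩ ih

lemma Joined.trans (h : Joined G S x y) (h' : Joined G S y z) : Joined G S x z :=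
  Relation.ReflTransGen.trans h h'

lemma Joined.mono (hST : S ⊆ T) (h : Joined G S x y) : Joined G T x y :=
  Relation.ReflTransGen.mono (fun _ _ h => ⟨h.1, hST h.2.1, hST h.2.2⟩) _ _ h

lemma Joined.single (h : G.Adj x y) (hx : x ∈ S) (hy : y ∈ S) : Joined G S x y :=
  Relation.ReflTransGen.single ⟨h, hx, hy⟩

lemma Joined.mem_right (h : Joined G S x y) (hx : x ∈ S) : y ∈ S := by
  induction h with
  | refl => exact hx
  | tail _ h _ => exact h.2.2

lemma conn_of_center (c : X) (h : ∀ x ∈ S, Joined G S x c) : Conn G S :=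
  fun x hx y hy => (h x hx).trans (h y hy).symm

lemma conn_singleton : Conn G {x} := by
  rintro _ rfl _ rfl; exact Joined.refl

lemma conn_pair (h : G.Adj x y) : Conn G {x, y} := by
  refine conn_of_center x ?_
  rintro z (rfl | rfl)
  · exact Joined.refl
  · exact Joined.single h.symm (by simp) (by simp)

lemma Conn.union (hS : Conn G S) (hT : Conn G T) (hS' : c ∈ S) (hT' : c ∈ T) :
    Conn G (S ∪ T) := by
  refine conn_of_center c ?_
  rintro x (hx | hx)
  · exact (hS x hx c hS').mono Set.subset_union_left
  · exact (hT x hx c hT').mono Set.subset_union_right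

lemma Conn.union_adj (hS : Conn G S) (hT : Conn G T) (ha : a ∈ S) (hb : b ∈ T)
    (hab : G.Adj a b) : Conn G (S ∪ T) := by
  refine conn_of_center a ?_
  rintro x (hx | hx)
  · exact (hS x hx a ha).mono Set.subset_union_left
  · exact ((hT x hx b hb).mono Set.subset_union_right).trans
      (Joined.single hab.symm (Or.inr hb) (Or.inl ha))

lemma bicon_pair (h : G.Adj x y) : Bicon G {x, y} := by
  refine ⟨conn_pair h, ?_⟩
  rintro z (rfl | rfl)
  · have : ({z, y} : Set X) \ {z} ⊆ {y} := by
      rintro u ⟨rfl | rfl, hu⟩ <;> simp_all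
    intro p hp r hr
    obtain rfl : p = y := this hp
    obtain rfl : r = p := this hr
    exact Joined.refl
  · have : ({x, z} : Set X) \ {z} ⊆ {x} := by
      rintro u ⟨rfl | rfl, hu⟩ <;> simp_all
    intro p hp r hr
    obtain rfl : p = x := this hp
    obtain rfl : r = p := this hr
    exact Joined.refl

lemma Bicon.union (hS : Bicon G S) (hT : Bicon G T) (hab : a ≠ b) (haS : a ∈ S) (hbS : b ∈ S)
    (haT : a ∈ T) (hbT : b ∈ T) : Bicon G (S ∪ T) := by
  refine ⟨hS.1.union hT.1 haS haT, fun z _ => ?_⟩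
  have key : ∀ U : Set X, Bicon G U → Conn G (U \ {z}) := by
    intro U hU
    by_cases hz : z ∈ U
    · exact hU.2 z hz
    · rw [Set.sdiff_singleton_eq_self hz]; exact hU.1
  rw [Set.union_sdiff_distrib]
  by_cases hz : z = a
  · exact (key S hS).union (key T hT) (c := b) ⟨hbS, by simp [hz, hab.symm]⟩
      ⟨hbT, by simp [hz, hab.symm]⟩
  · exact (key S hS).union (key T hT) (c := a) ⟨haS, by simpa using Ne.symm hz⟩
      ⟨haT, by simpa using Ne.symm hz⟩

/-- A connected set has an edge leaving any of its nonempty proper subsets. -/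
lemma Conn.exists_exit (hS : Conn G S) (hR : R ⊆ S) (ha : a ∈ R) (hb : b ∈ S) (hbR : b ∉ R) :
    ∃ x ∈ R, ∃ y ∈ S \ R, G.Adj x y := by
  by_contra! hcon
  have h := hS a (hR ha) b hb
  have : b ∈ R := by
    clear hb hbR
    induction h with
    | refl => exact ha
    | tail _ h ih =>
      by_contra hc
      exact hcon _ ih _ ⟨h.2.2, hc⟩ h.1
  exact hbR this

/-- Removing from a connected set a component of the complement of one of its vertices
leaves a connected set. -/
lemma Conn.diff_component (hS : Conn G S) (hq : q ∈ S) (hy : y ∈ S \ {q}) :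
    Conn G (S \ {z | Joined G (S \ {q}) y z}) ∧ q ∈ S \ {z | Joined G (S \ {q}) y z} := by
  have hqK : q ∈ S \ {z | Joined G (S \ {q}) y z} := by
    refine ⟨hq, fun h => ?_⟩
    exact (Joined.mem_right h hy).2 rfl
  refine ⟨conn_of_center q ?_, hqK⟩
  rintro x ⟨hx, hxK⟩
  have h := hS x hx q hq
  clear hx
  induction h using Relation.ReflTransGen.head_induction_on with
  | refl => exact Joined.refl
  | @head u u' h _ ih =>
    by_cases huq : u = q
    · rw [huq]; exact Joined.refl
    have hu' : u' ∉ {z | Joined G (S \ {q}) y z} := by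
      intro hu'
      have hu'q : u' ∈ S \ {q} := Joined.mem_right hu' hy
      exact hxK (Joined.trans hu' (Joined.single h.1.symm hu'q ⟨h.2.1, huq⟩))
    have hs : Joined G (S \ {z | Joined G (S \ {q}) y z}) u u' :=
      Joined.single h.1 ⟨h.2.1, hxK⟩ ⟨h.2.2, hu'⟩
    exact hs.trans (ih hu')

/-- A finite connected set with at least two points has a point, different from a given one,
whose removal leaves it connected. -/
lemma Conn.exists_noncut (hS : Conn G S) (hfin : S.Finite) (hv : v ∈ S) (hw : w ∈ S)
    (hvw : w ≠ v) : ∃ q ∈ S, q ≠ v ∧ Conn G (S \ {q}) := by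
  obtain ⟨R, ⟨hRS, hvR, hRc, hRne⟩, hmax⟩ := Set.exists_max_image
    {R | R ⊆ S ∧ v ∈ R ∧ Conn G R ∧ R ≠ S} Set.ncard
    (hfin.finite_subsets.subset fun R hR => hR.1)
    ⟨{v}, by simpa using hv, rfl, conn_singleton, fun h => hvw (by rw [← h] at hw; exact hw)⟩
  obtain ⟨b, hb, hbR⟩ := Set.exists_of_ssubset (hRS.ssubset_of_ne hRne)
  obtain ⟨x, hx, y, hy, hxy⟩ := hS.exists_exit hRS hvR hb hbR
  have hins : Conn G (R ∪ {y}) := hRc.union_adj conn_singleton hx rfl hxy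
  have hEq : R ∪ {y} = S := by
    by_contra hne
    have := hmax (R ∪ {y}) ⟨Set.union_subset hRS (by simpa using hy.1), Or.inl hvR, hins, hne⟩
    have hlt : R.ncard < (R ∪ {y}).ncard := by
      apply Set.ncard_lt_ncard _ (hfin.subset (Set.union_subset hRS (by simpa using hy.1)))
      exact ⟨Set.subset_union_left, fun h => hy.2 (h (Or.inr rfl))⟩
    omega
  refine ⟨y, hy.1, fun h => hy.2 (h ▸ hvR), ?_⟩
  have : S \ {y} = R := by
    rw [← hEq, Set.union_sdiff_right, Set.sdiff_singleton_eq_self hy.2]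
  rwa [this]

/-- Joined points lie in a common finite connected set. -/
lemma Joined.exists_finite (h : Joined G S x y) (hx : x ∈ S) :
    ∃ C ⊆ S, C.Finite ∧ Conn G C ∧ x ∈ C ∧ y ∈ C := by
  induction h with
  | refl => exact ⟨{x}, by simpa using hx, Set.finite_singleton x, conn_singleton, rfl, rfl⟩
  | tail _ h ih =>
    rename_i b c _
    obtain ⟨C, hCS, hCf, hCc, hxC, hbC⟩ := ih
    exact ⟨C ∪ {c}, Set.union_subset hCS (by simpa using h.2.2), hCf.union (Set.finite_singleton _),
      hCc.union_adj conn_singleton hbC rfl h.1, Or.inl hxC, Or.inr rfl⟩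

lemma exists_finite_conn {N : Set X} (hN : N.Finite) (hx : x ∈ S) (h : ∀ y ∈ N, Joined G S x y) :
    ∃ C ⊆ S, C.Finite ∧ Conn G C ∧ x ∈ C ∧ N ⊆ C := by
  induction N, hN using Set.Finite.induction_on with
  | empty => exact ⟨{x}, by simpa using hx, Set.finite_singleton x, conn_singleton, rfl, by simp⟩
  | @insert a N _ _ ih =>
    obtain ⟨C, h1, h2, h3, h4, h5⟩ := ih fun y hy => h y (Or.inr hy)
    obtain ⟨C', k1, k2, k3, k4, k5⟩ := (h a (Or.inl rfl)).exists_finite hx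
    exact ⟨C ∪ C', Set.union_subset h1 k1, h2.union k2, h3.union k3 h4 k4, Or.inl h4,
      Set.insert_subset (Or.inr k5) (h5.trans Set.subset_union_left)⟩

/-- The first step of a walk leaving `v` for good. -/
lemma exists_first_step {r : X → X → Prop} (h : Relation.ReflTransGen r v w) (hvw : w ≠ v) :
    ∃ z, r v z ∧ z ≠ v ∧ Relation.ReflTransGen (fun a b => r a b ∧ a ≠ v ∧ b ≠ v) z w := by
  induction h with
  | refl => exact absurd rfl hvw
  | @tail b c _ hbc ih =>
    by_cases hb : b = v
    · exact ⟨c, hb ▸ hbc, hvw, Relation.ReflTransGen.refl⟩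
    · obtain ⟨z, h1, h2, h3⟩ := ih hb
      exact ⟨z, h1, h2, h3.tail ⟨hbc, hb, hvw⟩⟩

/-- A shortest walk is injective. -/
lemma exists_injOn_path {r : X → X → Prop} (h : Relation.ReflTransGen r v w) :
    ∃ (n : ℕ) (p : ℕ → X), p 0 = v ∧ p n = w ∧ (∀ i < n, r (p i) (p (i + 1))) ∧
      Set.InjOn p (Set.Iic n) := by
  classical
  have hex : ∃ (n : ℕ) (p : ℕ → X), p 0 = v ∧ p n = w ∧ (∀ i < n, r (p i) (p (i + 1))) := by
    induction h with
    | refl => exact ⟨0, fun _ => v, rfl, rfl, by simp⟩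
    | @tail b c _ hbc ih =>
      obtain ⟨n, p, h0, hn, hp⟩ := ih
      refine ⟨n + 1, fun i => if i ≤ n then p i else c, by simp [h0], by simp, fun i hi => ?_⟩
      by_cases hin : i < n
      · simpa [hin.le, Nat.succ_le_of_lt hin] using hp i hin
      · obtain rfl : i = n := by omega
        simpa [hn] using hbc
  obtain ⟨p, h0, hn, hp⟩ := Nat.find_spec hex
  set n := Nat.find hex with hndef
  have key : ∀ i j, i < j → j ≤ n → p i ≠ p j := by
    intro i j hij hjn heq
    have hlt : n - (j - i) < n := by omega
    refine Nat.find_min hex hlt ⟨fun k => if k ≤ i then p k else p (k + (j - i)), ?_, ?_, ?_⟩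
    · simp [h0]
    · by_cases hc : n - (j - i) ≤ i
      · have e1 : n - (j - i) = i := by omega
        have e2 : j = n := by omega
        simp only [e1, le_refl, if_true]
        rw [heq, e2, hn]
      · have e1 : n - (j - i) + (j - i) = n := by omega
        simp only [hc, if_false, e1, hn]
    · intro k hk
      by_cases h1 : k + 1 ≤ i
      · simpa [h1, (by omega : k ≤ i)] using hp k (by omega)
      · by_cases h2 : k ≤ i
        · obtain rfl : k = i := by omega
          have := hp j (by omega)
          simp only [le_refl, if_true, h1, if_false]
          rw [heq]
          convert this using 2
          omega
        · have := hp (k + (j - i)) (by omega)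
          simp only [h1, h2, if_false]
          convert this using 2
          omega
  refine ⟨n, p, h0, hn, hp, fun i hi j hj hij => ?_⟩
  rcases lt_trichotomy i j with h | h | h
  · exact absurd hij (key i j h hj)
  · exact h
  · exact absurd hij.symm (key j i h hi)

/-- The vertices of a cycle form a biconnected set. -/
lemma bicon_cycle {n : ℕ} {p : ℕ → X} (hp : ∀ i < n, G.Adj (p i) (p (i + 1)))
    (hinj : Set.InjOn p (Set.Iic n)) (hclose : G.Adj (p n) (p 0)) :
    Bicon G (p '' Set.Iic n) := by
  have seg : ∀ (S : Set X) (i j : ℕ), i ≤ j → j ≤ n → (∀ k, i ≤ k → k ≤ j → p k ∈ S) →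
      Joined G S (p i) (p j) := by
    intro S i j hij
    induction j, hij using Nat.le_induction with
    | base => intros; exact Joined.refl
    | succ j hij ih =>
      intro hjn hS
      exact (ih (by omega) fun k h1 h2 => hS k h1 (by omega)).trans
        (Joined.single (hp j (by omega)) (hS j hij (by omega)) (hS _ (by omega) le_rfl))
  refine ⟨conn_of_center (p 0) ?_, ?_⟩
  · rintro _ ⟨i, hi, rfl⟩
    exact (seg (p '' Set.Iic n) 0 i (by omega) hi fun k _ hk => ⟨k, le_trans hk hi, rfl⟩).symm
  · rintro _ ⟨i, hi, rfl⟩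
    have hmem : ∀ k ≤ n, k ≠ i → p k ∈ p '' Set.Iic n \ {p i} := fun k hk hki =>
      ⟨⟨k, hk, rfl⟩, fun h => hki (hinj hk hi h)⟩
    have hlo : ∀ j, j < i → Joined G (p '' Set.Iic n \ {p i}) (p j) (p 0) := fun j hj =>
      (seg _ 0 j (by omega) (le_trans hj.le hi) fun k _ hk =>
        hmem k (le_trans (le_trans hk hj.le) hi) (by omega)).symm
    have hhi : ∀ j, i < j → j ≤ n → Joined G (p '' Set.Iic n \ {p i}) (p j) (p n) := fun j hj hjn =>
      seg _ j n hjn le_rfl fun k hk hkn => hmem k hkn (by omega)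
    have hi' : i ≤ n := hi
    by_cases hin : i = n
    · refine conn_of_center (p 0) ?_
      rintro _ ⟨⟨j, hj, rfl⟩, hne⟩
      have hj' : j ≤ n := hj
      exact hlo j (lt_of_le_of_ne (hin ▸ hj') fun h => hne (by rw [h]; rfl))
    · refine conn_of_center (p n) ?_
      rintro _ ⟨⟨j, hj, rfl⟩, hne⟩
      have hji : j ≠ i := fun h => hne (by rw [h]; rfl)
      rcases lt_or_gt_of_ne hji with h | h
      · exact (hlo j h).trans (Joined.single hclose.symm (hmem 0 (by omega) (by omega))
          (hmem n le_rfl (Ne.symm hin)))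
      · exact hhi j h hj

end Connectivity

/-- `S` has a proper coloring from the lists `L`. -/
def ListCol {X C : Type*} (G : SimpleGraph X) (S : Set X) (L : X → Finset C) : Prop :=
  ∃ col : X → C, (∀ v ∈ S, col v ∈ L v) ∧ ∀ u ∈ S, ∀ v ∈ S, G.Adj u v → col u ≠ col v

section ListColoring

variable {X : Type*} {G : SimpleGraph X} {S T R K : Set X} {a b c v w x y z q : X}

lemma dg_diff_adj (hS : S.Finite) (hx : x ∈ S) (h : G.Adj z x) :
    dg G (S \ {x}) z + 1 = dg G S z := by
  unfold dg
  have : G.neighborSet z ∩ (S \ {x}) = (G.neighborSet z ∩ S) \ {x} := by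
    ext u; simp [and_assoc]
  rw [this]
  exact Set.ncard_sdiff_singleton_add_one ⟨h, hx⟩ (hS.subset Set.inter_subset_right)

lemma dg_diff_not (h : ¬ G.Adj z x) : dg G (S \ {x}) z = dg G S z := by
  unfold dg
  congr 1
  ext u
  simp only [Set.mem_inter_iff, SimpleGraph.mem_neighborSet, Set.mem_sdiff, Set.mem_singleton_iff]
  refine ⟨fun h => ⟨h.1, h.2.1⟩, fun k => ⟨k.1, k.2, ?_⟩⟩
  rintro rfl
  exact h k.1

lemma dg_pos (hS : S.Finite) (hx : x ∈ S) (h : G.Adj z x) : 1 ≤ dg G S z := by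
  rw [← dg_diff_adj hS hx h]; omega

variable {C : Type*} [DecidableEq C] {L : X → Finset C}

open Classical in
lemma ListCol.of_delete {α : C} (hα : α ∈ L x)
    (h : ListCol G (S \ {x}) fun z => if G.Adj x z then (L z).erase α else L z) :
    ListCol G S L := by
  obtain ⟨col, h1, h2⟩ := h
  have hne : ∀ v ∈ S, v ≠ x → col v ∈ L v ∧ (G.Adj x v → col v ≠ α) := by
    intro v hv hvx
    have := h1 v ⟨hv, hvx⟩
    by_cases hxv : G.Adj x v
    · simp only [hxv, if_true, Finset.mem_erase] at this
      exact ⟨this.2, fun _ => this.1⟩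
    · simp only [hxv, if_false] at this
      exact ⟨this, fun h => absurd h hxv⟩
  refine ⟨fun v => if v = x then α else col v, fun v hv => ?_, fun u hu v hv huv => ?_⟩
  · by_cases hvx : v = x
    · simpa [hvx] using hα
    · simpa [hvx] using (hne v hv hvx).1
  · by_cases hux : u = x
    · have hvx : v ≠ x := fun h => huv.ne (hux.trans h.symm)
      simpa [hux, hvx] using ((hne v hv hvx).2 (hux ▸ huv)).symm
    · by_cases hvx : v = x
      · simpa [hux, hvx] using (hne u hu hux).2 (hvx ▸ huv.symm)
      · simpa [hux, hvx] using h2 u ⟨hu, hux⟩ v ⟨hv, hvx⟩ huv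

open Classical in
lemma le_card_delete {α : C} (hS : S.Finite) (hx : x ∈ S) (h : dg G S z ≤ (L z).card) :
    dg G (S \ {x}) z ≤ (if G.Adj x z then (L z).erase α else L z).card := by
  by_cases hz : G.Adj x z
  · have := dg_diff_adj hS hx hz.symm
    have := Finset.pred_card_le_card_erase (s := L z) (a := α)
    simp only [hz, if_true]
    omega
  · simpa [hz, dg_diff_not (S := S) fun h => hz h.symm] using h

/-- Degree-list-coloring of a connected set having a vertex with a longer list. -/
lemma ListCol.of_root (hS : S.Finite) (hc : Conn G S) (hv : v ∈ S)
    (hL : ∀ z ∈ S, dg G S z ≤ (L z).card) (hv' : dg G S v < (L v).card) : ListCol G S L := by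
  classical
  induction hn : S.ncard generalizing S L with
  | zero =>
    rw [Set.ncard_eq_zero hS] at hn
    simp [hn] at hv
  | succ n ih =>
    by_cases hw : ∃ w ∈ S, w ≠ v
    · obtain ⟨w, hw, hwv⟩ := hw
      obtain ⟨q, hq, hqv, hqc⟩ := hc.exists_noncut hS hv hw hwv
      obtain ⟨r, hr, y, hy, hry⟩ := hc.exists_exit (R := {q}) (by simpa using hq) rfl hv
        (by simpa using Ne.symm hqv)
      obtain rfl : r = q := hr
      have h1 := dg_pos hS hy.1 hry
      obtain ⟨α, hα⟩ : (L r).Nonempty := Finset.card_pos.1 (h1.trans (hL r hq))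
      refine ListCol.of_delete hα (ih (hS.subset Set.sdiff_subset) hqc ⟨hv, Ne.symm hqv⟩
        (fun z hz => le_card_delete hS hq (hL z hz.1)) ?_ ?_)
      · by_cases hz : G.Adj r v
        · have := dg_diff_adj hS hq hz.symm
          have := Finset.pred_card_le_card_erase (s := L v) (a := α)
          simp only [hz, if_true]
          omega
        · simpa [hz, dg_diff_not (S := S) fun h => hz h.symm] using hv'
      · have := Set.ncard_sdiff_singleton_add_one hq hS
        omega
    · push Not at hw
      obtain ⟨α, hα⟩ : (L v).Nonempty := Finset.card_pos.1 (by omega)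
      refine ⟨fun _ => α, fun z hz => by rw [hw z hz]; exact hα, fun a ha b hb hab => ?_⟩
      rw [hw a ha, hw b hb] at hab
      exact absurd rfl hab.ne

/-- Degree-list-coloring of a biconnected set which is not regular. -/
lemma ListCol.of_not_regular (hS : S.Finite) (hb : Bicon G S)
    (hreg : ¬ ∃ k, ∀ v ∈ S, dg G S v = k)
    (hL : ∀ z ∈ S, dg G S z ≤ (L z).card) : ListCol G S L := by
  classical
  by_cases h1 : ∃ x ∈ S, ∃ y ∈ S, G.Adj x y ∧ ∃ α ∈ L x, α ∉ L y
  · obtain ⟨x, hx, y, hy, hxy, α, hα, hαy⟩ := h1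
    refine ListCol.of_delete hα (ListCol.of_root (v := y) (hS.subset Set.sdiff_subset) (hb.2 x hx)
      ⟨hy, hxy.ne'⟩ (fun z hz => le_card_delete hS hx (hL z hz.1)) ?_)
    have := dg_diff_adj hS hx hxy.symm
    have := hL y hy
    simp only [hxy, if_true, Finset.erase_eq_of_notMem hαy]
    omega
  push Not at h1
  by_cases h2 : ∃ v ∈ S, dg G S v < (L v).card
  · obtain ⟨v, hv, hlt⟩ := h2
    exact ListCol.of_root hS hb.1 hv hL hlt
  push Not at h2
  have heq : ∀ x ∈ S, ∀ y ∈ S, L x = L y := by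
    intro x hx y hy
    have := hb.1 x hx y hy
    clear hy
    induction this with
    | refl => rfl
    | tail _ h ih =>
      exact ih.trans (Finset.Subset.antisymm (h1 _ h.2.1 _ h.2.2 h.1)
        (h1 _ h.2.2 _ h.2.1 h.1.symm))
  refine absurd ?_ hreg
  by_cases hne : S.Nonempty
  · obtain ⟨x, hx⟩ := hne
    exact ⟨(L x).card, fun v hv => by
      rw [← heq v hv x hx]; exact le_antisymm (hL v hv) (h2 v hv)⟩
  · exact ⟨0, fun v hv => absurd ⟨v, hv⟩ hne⟩

end ListColoring

/-- `Y` is a union of components of `G` which is `d`-regular, locally finite, without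
`(d+1)`-cliques, and all of whose finite biconnected subsets are regular. -/
structure Tame {X : Type*} (G : SimpleGraph X) (d : ℕ) (Y : Set X) : Prop where
  three_le : 3 ≤ d
  fin : ∀ x, (G.neighborSet x).Finite
  inv : ∀ x y, G.Adj x y → x ∈ Y → y ∈ Y
  deg : ∀ x ∈ Y, (G.neighborSet x).ncard = d
  free : G.CliqueFree (d + 1)
  reg : ∀ S ⊆ Y, S.Finite → Bicon G S → ∃ k, ∀ v ∈ S, dg G S v = k

section Gallai

variable {X : Type*} {G : SimpleGraph X} {d : ℕ} {Y S S' T R K Q : Set X}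
  {a b c v w x y z q s₁ s₂ : X}

/-- At least two vertices of `S` have a neighbor in `R`. -/
def Attach {X : Type*} (G : SimpleGraph X) (S R : Set X) : Prop :=
  ∃ s₁ ∈ S, ∃ s₂ ∈ S, s₁ ≠ s₂ ∧ (∃ r ∈ R, G.Adj s₁ r) ∧ ∃ r ∈ R, G.Adj s₂ r

lemma Tame.inv_joined (hY : Tame G d Y) (h : Joined G S x y) (hx : x ∈ Y) : y ∈ Y := by
  induction h with
  | refl => exact hx
  | tail _ h ih => exact hY.inv _ _ h.1 ih

/-- Adding a vertex to a minimal connected set spanning its neighbors gives a biconnected set. -/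
lemma bicon_insert (hQ : Conn G Q) (hN : G.neighborSet v ⊆ Q) (hne : (G.neighborSet v).Nonempty)
    (hv : v ∉ Q)
    (hmin : ∀ Q' ⊆ Q, Conn G Q' → G.neighborSet v ⊆ Q' → Q' = Q) : Bicon G (insert v Q) := by
  obtain ⟨u, hu⟩ := hne
  refine ⟨?_, ?_⟩
  · rw [Set.insert_eq]
    exact conn_singleton.union_adj hQ rfl (hN hu) hu
  · rintro z (rfl | hz)
    · rwa [Set.insert_sdiff_self_of_notMem hv]
    · have hzv : v ≠ z := fun h => hv (h ▸ hz)
      refine conn_of_center v ?_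
      rintro y ⟨rfl | hy, hyz⟩
      · exact Joined.refl
      obtain ⟨hc, hzK⟩ := hQ.diff_component hz ⟨hy, hyz⟩
      by_cases hcon : ∃ p, G.Adj v p ∧ Joined G (Q \ {z}) y p
      · obtain ⟨p, hvp, hyp⟩ := hcon
        have hsub : Q \ {z} ⊆ insert v Q \ {z} := fun t ht => ⟨Or.inr ht.1, ht.2⟩
        exact (hyp.mono hsub).trans (Joined.single hvp.symm
          (hsub (hyp.mem_right ⟨hy, hyz⟩)) ⟨Or.inl rfl, hzv⟩)
      · push Not at hcon
        have := hmin _ Set.sdiff_subset hc fun p hp => ⟨hN hp, hcon p hp⟩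
        have hy' : y ∈ Q \ {p | Joined G (Q \ {z}) y p} := by rw [this]; exact hy
        exact absurd Joined.refl hy'.2

/-- A minimal ear added to a biconnected set. -/
lemma bicon_union_ear (hS : Bicon G S) (hR : Conn G R) (hdisj : ∀ z ∈ R, z ∉ S)
    (hatt : Attach G S R)
    (hmin : ∀ R' ⊆ R, Conn G R' → Attach G S R' → R' = R) : Bicon G (S ∪ R) := by
  have hatt' := hatt
  obtain ⟨s₁, hs₁, s₂, hs₂, hne, ⟨r₁, hr₁, ha₁⟩, r₂, hr₂, ha₂⟩ := hatt
  refine ⟨hS.1.union_adj hR hs₁ hr₁ ha₁, ?_⟩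
  rintro z (hz | hz)
  · have hzR : z ∉ R := fun h => hdisj z h hz
    rw [Set.union_sdiff_distrib, Set.sdiff_singleton_eq_self hzR]
    by_cases h : s₁ = z
    · exact (hS.2 z hz).union_adj hR ⟨hs₂, fun h' => hne (h.trans h'.symm)⟩ hr₂ ha₂
    · exact (hS.2 z hz).union_adj hR ⟨hs₁, h⟩ hr₁ ha₁
  · have hzS : z ∉ S := hdisj z hz
    rw [Set.union_sdiff_distrib, Set.sdiff_singleton_eq_self hzS]
    refine conn_of_center s₁ ?_
    rintro y (hy | hy)
    · exact (hS.1 y hy s₁ hs₁).mono Set.subset_union_left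
    obtain ⟨hc, hzK⟩ := hR.diff_component hz hy
    by_cases hcon : ∃ p, ∃ s ∈ S, G.Adj s p ∧ Joined G (R \ {z}) y p
    · obtain ⟨p, s, hs, hsp, hyp⟩ := hcon
      have e1 : Joined G (S ∪ R \ {z}) y p := hyp.mono Set.subset_union_right
      have e2 : Joined G (S ∪ R \ {z}) p s :=
        Joined.single hsp.symm (Or.inr (hyp.mem_right hy)) (Or.inl hs)
      exact e1.trans (e2.trans ((hS.1 s hs s₁ hs₁).mono Set.subset_union_left))
    · push Not at hcon
      have := hmin _ Set.sdiff_subset hc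
        ⟨s₁, hs₁, s₂, hs₂, hne, ⟨r₁, ⟨hr₁, hcon _ _ hs₁ ha₁⟩, ha₁⟩,
          ⟨r₂, ⟨hr₂, hcon _ _ hs₂ ha₂⟩, ha₂⟩⟩
      have hy' : y ∈ R \ {p | Joined G (R \ {z}) y p} := by rw [this]; exact hy.1
      exact absurd Joined.refl hy'.2

/-- A proper biconnected subset has an ear. -/
lemma exists_ear (hfin : S.Finite) (hS : Bicon G S) (hS'S : S' ⊆ S) (hne : S' ≠ S)
    (hab : a ≠ b) (ha : a ∈ S') (hb : b ∈ S') :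
    ∃ R ⊆ S \ S', Conn G R ∧ Attach G S' R ∧
      ∀ R' ⊆ R, Conn G R' → Attach G S' R' → R' = R := by
  have hex : ∃ R ⊆ S \ S', Conn G R ∧ Attach G S' R := by
    obtain ⟨t, ht, htS⟩ := Set.exists_of_ssubset (hS'S.ssubset_of_ne hne)
    obtain ⟨x, hx, y, hy, hxy⟩ := hS.1.exists_exit hS'S ha ht htS
    have hsub : {z | Joined G (S \ S') y z} ⊆ S \ S' := fun z hz => Joined.mem_right hz hy
    obtain ⟨s, hs, hsx⟩ : ∃ s ∈ S', s ≠ x := by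
      by_cases h : a = x
      · exact ⟨b, hb, fun h' => hab (h.trans h'.symm)⟩
      · exact ⟨a, ha, h⟩
    obtain ⟨p, hp, q, hq, hpq⟩ := (hS.2 x (hS'S hx)).exists_exit
      (R := {z | Joined G (S \ S') y z}) (a := y) (b := s)
      (fun z hz => ⟨(hsub hz).1, fun h => (hsub hz).2 (h ▸ hx)⟩) Joined.refl
      ⟨hS'S hs, hsx⟩ (fun h => (hsub h).2 hs)
    have hqS' : q ∈ S' := by
      by_contra hc
      exact hq.2 (Joined.trans hp (Joined.single hpq (hsub hp) ⟨hq.1.1, hc⟩))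
    refine ⟨{z | Joined G (S \ S') y z}, hsub, conn_of_center y ?_, x, hx, q, hqS',
      fun h => hq.1.2 h.symm, ⟨y, Joined.refl, hxy⟩, ⟨p, hp, hpq.symm⟩⟩
    intro z hz
    have hz' : Joined G (S \ S') z y := Joined.symm hz
    clear hz
    induction hz' using Relation.ReflTransGen.head_induction_on with
    | refl => exact Joined.refl
    | @head u u' h hu' ih =>
      refine Joined.trans (Joined.single h.1 ?_ ?_) ih
      · exact Joined.symm (Joined.trans (Joined.single h.1 h.2.1 h.2.2) hu')
      · exact Joined.symm hu'
  obtain ⟨R, ⟨h1, h2, h3⟩, hmin⟩ := Set.exists_min_image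
    {R | R ⊆ S \ S' ∧ Conn G R ∧ Attach G S' R} Set.ncard
    ((hfin.subset Set.sdiff_subset).finite_subsets.subset fun R hR => hR.1) hex
  refine ⟨R, h1, h2, h3, fun R' hR' hc hatt => ?_⟩
  exact Set.eq_of_subset_of_ncard_le hR' (hmin R' ⟨hR'.trans h1, hc, hatt⟩)
    (hfin.subset (h1.trans Set.sdiff_subset))

lemma dg_union_of_disjoint (hfin : (G.neighborSet x).Finite) (h : ∀ z ∈ R, z ∉ S) :
    dg G (S ∪ R) x = dg G S x + dg G R x := by
  unfold dg
  rw [Set.inter_union_distrib_left]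
  refine Set.ncard_union_eq ?_ (hfin.subset Set.inter_subset_left)
    (hfin.subset Set.inter_subset_left)
  exact Set.disjoint_left.2 fun z hz hz' => h z hz'.2 hz.2

lemma dg_mono (hfin : (G.neighborSet x).Finite) (h : S ⊆ T) : dg G S x ≤ dg G T x :=
  Set.ncard_le_ncard (Set.inter_subset_inter_right _ h) (hfin.subset Set.inter_subset_left)

/-- A finite set of `d + 1` vertices of inner degree `d` is a clique. -/
lemma not_cliqueFree (hfin : S.Finite) (hcard : S.ncard = d + 1) (h : ∀ x ∈ S, dg G S x = d) :
    ¬ G.CliqueFree (d + 1) := by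
  intro hfree
  refine hfree hfin.toFinset ⟨?_, ?_⟩
  · intro x hx y hy hxy
    simp only [Set.Finite.coe_toFinset] at hx hy
    have hsub : G.neighborSet x ∩ S ⊆ S \ {x} := fun z hz => ⟨hz.2, fun h => by
      have : z = x := h
      subst this
      exact G.loopless.irrefl _ hz.1⟩
    have heq := Set.eq_of_subset_of_ncard_le hsub (by
      have := Set.ncard_sdiff_singleton_add_one hx hfin
      have h' : (G.neighborSet x ∩ S).ncard = d := h x hx
      omega) (hfin.subset Set.sdiff_subset)
    have : y ∈ S \ {x} := ⟨hy, Ne.symm hxy⟩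
    rw [← heq] at this
    exact this.1
  · rw [← Set.ncard_eq_toFinset_card S hfin, hcard]

/-- Some two neighbors of `v` are separated by `v`. -/
lemma Tame.exists_separated (hY : Tame G d Y) (hv : v ∈ Y) :
    ∃ u w, G.Adj v u ∧ G.Adj v w ∧ ¬ Joined G {v}ᶜ u w := by
  by_contra! hcon
  have hd := hY.three_le
  have hNd := hY.deg v hv
  have hNne : (G.neighborSet v).Nonempty := by
    apply Set.nonempty_of_ncard_ne_zero; omega
  obtain ⟨u₀, hu₀⟩ := hNne
  obtain ⟨C, hCv, hCf, hCc, -, hNC⟩ := exists_finite_conn (S := {v}ᶜ) (x := u₀) (hY.fin v)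
    (G.ne_of_adj hu₀).symm fun y hy => hcon u₀ y hu₀ hy
  obtain ⟨Q, ⟨hQC, hQc, hNQ⟩, hmin⟩ := Set.exists_min_image
    {Q | Q ⊆ C ∧ Conn G Q ∧ G.neighborSet v ⊆ Q} Set.ncard
    (hCf.finite_subsets.subset fun R hR => hR.1) ⟨C, subset_rfl, hCc, hNC⟩
  have hQf : Q.Finite := hCf.subset hQC
  have hvQ : v ∉ Q := fun h => hCv (hQC h) rfl
  have hb : Bicon G (insert v Q) := bicon_insert hQc hNQ ⟨u₀, hu₀⟩ hvQ fun Q' h1 h2 h3 =>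
    Set.eq_of_subset_of_ncard_le h1 (hmin Q' ⟨h1.trans hQC, h2, h3⟩) hQf
  set S := insert v Q with hSdef
  have hSf : S.Finite := hQf.insert v
  have hvS : v ∈ S := Or.inl rfl
  have hSY : S ⊆ Y := fun x hx => hY.inv_joined (hb.1 v hvS x hx) hv
  have hSd : ∀ x ∈ S, dg G S x = d := by
    obtain ⟨k, hk⟩ := hY.reg S hSY hSf hb
    have : dg G S v = d := by
      unfold dg
      rw [Set.inter_eq_self_of_subset_left (hNQ.trans (Set.subset_insert _ _)), hNd]
    intro x hx
    rw [hk x hx, ← hk v hvS, this]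
  have hScard : d + 1 ≤ S.ncard := by
    have h1 := Set.ncard_le_ncard hNQ hQf
    rw [hSdef, Set.ncard_insert_of_notMem hvQ hQf]
    omega
  obtain ⟨S', ⟨hS'S, hS'b, hS'ne, x₁, hx₁, x₂, hx₂, hx₁₂⟩, hmax⟩ := Set.exists_max_image
    {S' | S' ⊆ S ∧ Bicon G S' ∧ S' ≠ S ∧ ∃ x₁ ∈ S', ∃ x₂ ∈ S', x₁ ≠ x₂} Set.ncard
    (hSf.finite_subsets.subset fun R hR => hR.1) ⟨{v, u₀}, by
      refine ⟨?_, bicon_pair hu₀, ?_, v, by simp, u₀, by simp, G.ne_of_adj hu₀⟩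
      · rintro _ (rfl | rfl)
        exacts [hvS, Or.inr (hNQ hu₀)]
      · intro h
        have := Set.ncard_insert_le v {u₀}
        rw [h, Set.ncard_singleton] at this
        omega⟩
  have hS'f : S'.Finite := hSf.subset hS'S
  obtain ⟨k, hk⟩ := hY.reg S' (hS'S.trans hSY) hS'f hS'b
  obtain ⟨R, hRS, hRc, hRatt, hRmin⟩ := exists_ear hSf hb hS'S hS'ne hx₁₂ hx₁ hx₂
  have hdisj : ∀ z ∈ R, z ∉ S' := fun z hz => (hRS hz).2
  have hRf : R.Finite := hSf.subset (hRS.trans Set.sdiff_subset)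
  have hunion : S' ∪ R = S := by
    by_contra hne
    have := hmax (S' ∪ R) ⟨Set.union_subset hS'S (hRS.trans Set.sdiff_subset),
      bicon_union_ear hS'b hRc hdisj hRatt hRmin, hne, x₁, Or.inl hx₁, x₂, Or.inl hx₂, hx₁₂⟩
    obtain ⟨s, -, -, -, -, ⟨r, hr, -⟩, -⟩ := hRatt
    have hlt : S'.ncard < (S' ∪ R).ncard := Set.ncard_lt_ncard
      ⟨Set.subset_union_left, fun h => hdisj r hr (h (Or.inr hr))⟩ (hS'f.union hRf)
    omega
  have hsum : ∀ s ∈ S', k + dg G R s = d := by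
    intro s hs
    rw [← hk s hs, ← dg_union_of_disjoint (hY.fin s) hdisj, hunion, hSd s (hS'S hs)]
  have hkd : k < d := by
    obtain ⟨s, hs, -, -, -, ⟨r, hr, hsr⟩, -⟩ := hRatt
    have := dg_pos hRf hr hsr
    have := hsum s hs
    omega
  have hnbr : ∀ s ∈ S', ∃ r ∈ R, G.Adj s r := by
    intro s hs
    have h1 := hsum s hs
    have : (G.neighborSet s ∩ R).Nonempty := by
      apply Set.nonempty_of_ncard_ne_zero
      have : dg G R s ≠ 0 := by omega
      exact this
    exact this.imp fun r hr => ⟨hr.2, hr.1⟩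
  obtain ⟨r₀, hr₀, -⟩ := hnbr x₁ hx₁
  by_cases hR2 : ∃ r ∈ R, r ≠ r₀
  · obtain ⟨r, hr, hrr⟩ := hR2
    obtain ⟨q, hq, hqr, hqc⟩ := hRc.exists_noncut hRf hr₀ hr hrr
    have hA : ¬ Attach G S' (R \ {q}) := fun h => by
      have := hRmin _ Set.sdiff_subset hqc h
      rw [← this] at hq
      exact hq.2 rfl
    have hB : ¬ Attach G S' {q} := fun h => by
      have := hRmin {q} (by simpa using hq) conn_singleton h
      rw [← this] at hr₀
      exact hqr hr₀.symm
    have hA' : ∀ s ∈ S', ∀ s' ∈ S', (∃ r ∈ R \ {q}, G.Adj s r) → (∃ r ∈ R \ {q}, G.Adj s' r) →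
        s = s' := fun s hs s' hs' h h' => by
      by_contra hne; exact hA ⟨s, hs, s', hs', hne, h, h'⟩
    have hB' : ∀ s ∈ S', ∀ s' ∈ S', G.Adj s q → G.Adj s' q → s = s' := fun s hs s' hs' h h' => by
      by_contra hne; exact hB ⟨s, hs, s', hs', hne, ⟨q, rfl, h⟩, ⟨q, rfl, h'⟩⟩
    have hor : ∀ s ∈ S', G.Adj s q ∨ ∃ r ∈ R \ {q}, G.Adj s r := by
      intro s hs
      obtain ⟨r, hr, hsr⟩ := hnbr s hs
      by_cases h : r = q
      · exact Or.inl (h ▸ hsr)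
      · exact Or.inr ⟨r, ⟨hr, h⟩, hsr⟩
    have main : ∀ s ∈ S', ∀ s' ∈ S', s ≠ s' → G.Adj s q → (∃ r ∈ R \ {q}, G.Adj s' r) → False := by
      intro s hs s' hs' hne h h'
      have e1 : dg G R s ≤ 1 := by
        unfold dg
        rw [← Set.ncard_singleton q]
        refine Set.ncard_le_ncard (fun t ht => ?_)
        by_contra htq
        exact hne (hA' s hs s' hs' ⟨t, ⟨ht.2, htq⟩, ht.1⟩ h')
      have e2 : dg G S' s ≤ 1 := by
        unfold dg
        rw [← Set.ncard_singleton s']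
        refine Set.ncard_le_ncard (fun t ht => ?_)
        rcases hor t ht.2 with h1 | h1
        · exact absurd (hB' s hs t ht.2 h h1) (G.ne_of_adj ht.1)
        · exact hA' t ht.2 s' hs' h1 h'
      have := hsum s hs
      have := hk s hs
      omega
    rcases hor x₁ hx₁ with h1 | h1 <;> rcases hor x₂ hx₂ with h2 | h2
    · exact hx₁₂ (hB' _ hx₁ _ hx₂ h1 h2)
    · exact main _ hx₁ _ hx₂ hx₁₂ h1 h2
    · exact main _ hx₂ _ hx₁ hx₁₂.symm h2 h1
    · exact hx₁₂ (hA' _ hx₁ _ hx₂ h1 h2)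
  · push Not at hR2
    have hReq : R = {r₀} := by
      ext t; exact ⟨hR2 t, fun h => by rw [h]; exact hr₀⟩
    have hadj : ∀ s ∈ S', G.Adj s r₀ := fun s hs => by
      obtain ⟨r, hr, hsr⟩ := hnbr s hs
      exact hR2 r hr ▸ hsr
    have hS'card : S'.ncard = d := by
      rw [← hSd r₀ (hRS hr₀).1, dg, ← hunion, hReq]
      congr 1
      ext t
      constructor
      · exact fun ht => ⟨(hadj t ht).symm, Or.inl ht⟩
      · rintro ⟨h1, h2 | h2⟩
        · exact h2
        · exact absurd (Eq.symm h2) (G.ne_of_adj h1)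
    refine not_cliqueFree hSf ?_ hSd hY.free
    rw [← hunion, Set.union_comm, hReq, ← Set.insert_eq,
      Set.ncard_insert_of_notMem (hdisj r₀ hr₀) hS'f, hS'card]

/-- Each edge lies in a finite biconnected set absorbing all finite biconnected sets
that it meets in two points. -/
lemma Tame.exists_block (hY : Tame G d Y) (hv : v ∈ Y) (hvw : G.Adj v w) :
    ∃ B ⊆ Y, B.Finite ∧ v ∈ B ∧ w ∈ B ∧ ∀ S, S.Finite → Bicon G S →
      ∀ a ∈ S, ∀ b ∈ S, a ≠ b → a ∈ B → b ∈ B → S ⊆ B := by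
  classical
  let P : ℕ → Prop := fun k => ∃ B ⊆ Y, B.Finite ∧ Bicon G B ∧ v ∈ B ∧ w ∈ B ∧
    ∀ x ∈ B, dg G B x = k
  have hbound : ∀ k, P k → k ≤ d := by
    rintro k ⟨B, hBY, -, -, hvB, -, hB⟩
    rw [← hB v hvB, ← hY.deg v hv]
    exact Set.ncard_le_ncard Set.inter_subset_left (hY.fin v)
  have hPex : ∃ k, P k := by
    have hsub : {v, w} ⊆ Y := by
      rintro _ (rfl | rfl)
      exacts [hv, hY.inv _ _ hvw hv]
    obtain ⟨k, hk⟩ := hY.reg {v, w} hsub (Set.toFinite _) (bicon_pair hvw)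
    exact ⟨k, {v, w}, hsub, Set.toFinite _, bicon_pair hvw, by simp, by simp, hk⟩
  obtain ⟨k₀, hk₀⟩ := hPex
  have hsp := Nat.findGreatest_spec (P := P) (hbound k₀ hk₀) hk₀
  set k := Nat.findGreatest P d with hkdef
  obtain ⟨B, hBY, hBf, hBb, hvB, hwB, hB⟩ := hsp
  refine ⟨B, hBY, hBf, hvB, hwB, fun S hSf hSb a haS b hbS hab haB hbB => ?_⟩
  by_contra hnot
  obtain ⟨t, htS, htB⟩ := Set.not_subset.1 hnot
  have hU := hBb.union hSb hab haB hbB haS hbS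
  have hUY : B ∪ S ⊆ Y := fun x hx => hY.inv_joined (hU.1 v (Or.inl hvB) x hx) hv
  obtain ⟨k', hk'⟩ := hY.reg _ hUY (hBf.union hSf) hU
  have hle : k' ≤ k := Nat.le_findGreatest (hbound k' ⟨_, hUY, hBf.union hSf, hU, Or.inl hvB,
    Or.inl hwB, hk'⟩) ⟨_, hUY, hBf.union hSf, hU, Or.inl hvB, Or.inl hwB, hk'⟩
  obtain ⟨x, hx, y, hy, hxy⟩ := hU.1.exists_exit (R := B) Set.subset_union_left hvB
    (Or.inr htS) htB
  have h1 := dg_union_of_disjoint (R := {y}) (S := B) (hY.fin x) (by rintro z rfl; exact hy.2)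
  have h2 := dg_pos (S := {y}) (Set.finite_singleton y) rfl hxy
  have h3 : dg G (B ∪ {y}) x ≤ dg G (B ∪ S) x := dg_mono (hY.fin x)
    (Set.union_subset Set.subset_union_left (by simpa using hy.1))
  rw [hk' x (Or.inl hx)] at h3
  rw [hB x hx] at h1
  omega

end Gallai

/-- The label of an edge, given an injection of the vertices into the reals. -/
noncomputable def lab {X : Type*} (φ : X → ℝ) (a b : X) : ℝ ×ₗ ℝ :=
  toLex (max (φ a) (φ b), min (φ a) (φ b))

/-- The minimal spanning forest of `G` on `Y` for the edge labels `lab φ`. -/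
def tree {X : Type*} (G : SimpleGraph X) (Y : Set X) (φ : X → ℝ) : SimpleGraph X where
  Adj v w := G.Adj v w ∧ v ∈ Y ∧ w ∈ Y ∧
    ¬ Relation.ReflTransGen (fun a b => G.Adj a b ∧ lab φ a b < lab φ v w) v w
  symm := by
    refine ⟨?_⟩
    rintro v w ⟨h1, h2, h3, h4⟩
    have hl : lab φ w v = lab φ v w := by unfold lab; rw [max_comm, min_comm]
    refine ⟨h1.symm, h3, h2, fun h => h4 ?_⟩
    rw [hl] at h
    clear h2 h3 h4 hl h1
    generalize lab φ v w = t at h ⊢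
    induction h with
    | refl => exact Relation.ReflTransGen.refl
    | @tail b c _ h ih =>
      have hl : lab φ b c = lab φ c b := by unfold lab; rw [max_comm, min_comm]
      exact Relation.ReflTransGen.head ⟨h.1.symm, hl ▸ h.2⟩ ih
  loopless := ⟨fun v h => G.loopless.irrefl v h.1⟩

/-- `v` has at least three `T`-neighbors in `U`. -/
def Deg3 {X : Type*} (T : SimpleGraph X) (U : Set X) (v : X) : Prop :=
  ∃ a b c, a ≠ b ∧ a ≠ c ∧ b ≠ c ∧ (T.Adj v a ∧ a ∈ U) ∧ (T.Adj v b ∧ b ∈ U) ∧ T.Adj v c ∧ c ∈ U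

section Tree

variable {X : Type*} {G : SimpleGraph X} {d : ℕ} {Y U : Set X} {φ : X → ℝ}
  {a b c e v w x y z p q : X}

lemma lab_comm : lab φ a b = lab φ b a := by unfold lab; rw [max_comm, min_comm]

lemma lab_inj (hφ : Function.Injective φ) (h : lab φ a b = lab φ c e) :
    (a = c ∧ b = e) ∨ (a = e ∧ b = c) := by
  have h := toLex.injective h
  rw [Prod.mk.injEq] at h
  obtain ⟨h1, h2⟩ := h
  rcases le_total (φ a) (φ b) with hab | hab <;> rcases le_total (φ c) (φ e) with hce | hce <;>
    simp only [max_eq_left, max_eq_right, min_eq_left, min_eq_right, hab, hce] at h1 h2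
  · exact Or.inl ⟨hφ h2, hφ h1⟩
  · exact Or.inr ⟨hφ h2, hφ h1⟩
  · exact Or.inr ⟨hφ h1, hφ h2⟩
  · exact Or.inl ⟨hφ h1, hφ h2⟩

lemma rtg_segment {r : X → X → Prop} {f : ℕ → X} {i j : ℕ} (hij : i ≤ j)
    (h : ∀ k, i ≤ k → k < j → r (f k) (f (k + 1))) : Relation.ReflTransGen r (f i) (f j) := by
  induction j, hij using Nat.le_induction with
  | base => exact Relation.ReflTransGen.refl
  | succ j hij ih => exact (ih fun k h1 h2 => h k h1 (by omega)).tail (h j hij (by omega))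

lemma tree_no_cycle (hφ : Function.Injective φ) {m : ℕ} (hm : 3 ≤ m) {f : ℕ → X}
    (hf : ∀ i < m, (tree G Y φ).Adj (f i) (f (i + 1))) (hinj : Set.InjOn f (Set.Iio m))
    (hclose : f m = f 0) : False := by
  obtain ⟨j, hj, hmax⟩ := (Finset.range m).exists_max_image (fun i => lab φ (f i) (f (i + 1)))
    ⟨0, by simp; omega⟩
  simp only [Finset.mem_range] at hj hmax
  have hne : ∀ i k, i < k → k < m → lab φ (f i) (f (i + 1)) ≠ lab φ (f k) (f (k + 1)) := by
    intro i k hik hk heq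
    rcases lab_inj hφ heq with ⟨h, -⟩ | ⟨h1, h2⟩
    · exact hik.ne (hinj (show i < m by omega) hk h)
    · have e1 : i + 1 = k := hinj (show i + 1 < m by omega) hk h2
      by_cases hkm : k + 1 = m
      · rw [hkm, hclose] at h1
        have := hinj (show i < m by omega) (show 0 < m by omega) h1
        omega
      · have := hinj (show i < m by omega) (show k + 1 < m by omega) h1
        omega
  have hlt : ∀ i, i < m → i ≠ j → lab φ (f i) (f (i + 1)) < lab φ (f j) (f (j + 1)) := by
    intro i hi hij
    refine lt_of_le_of_ne (hmax i hi) ?_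
    rcases lt_or_gt_of_ne hij with h | h
    · exact hne i j h hj
    · exact (hne j i h hi).symm
  have h1 : Relation.ReflTransGen (fun a b => G.Adj a b ∧ lab φ a b < lab φ (f (j + 1)) (f j))
      (f (j + 1)) (f j) := by
    rw [lab_comm]
    have s1 := rtg_segment (r := fun a b => G.Adj a b ∧ lab φ a b < lab φ (f j) (f (j + 1)))
      (f := f) (i := j + 1) (j := m) hj fun k h1 h2 => ⟨(hf k h2).1, hlt k h2 (by omega)⟩
    have s2 := rtg_segment (r := fun a b => G.Adj a b ∧ lab φ a b < lab φ (f j) (f (j + 1)))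
      (f := f) (i := 0) (j := j) (by omega) fun k h1 h2 =>
        ⟨(hf k (by omega)).1, hlt k (by omega) (by omega)⟩
    rw [hclose] at s1
    exact s1.trans s2
  exact (hf j hj).symm.2.2.2 h1

/-- Two neighbors of a vertex of the forest are separated by it. -/
lemma tree_separates (hφ : Function.Injective φ) (hp : (tree G Y φ).Adj z p)
    (hq : (tree G Y φ).Adj z q) (hpq : p ≠ q) : ¬ Joined (tree G Y φ) {z}ᶜ p q := by
  intro h
  obtain ⟨n, f, h0, hn, hf, hinj⟩ := exists_injOn_path h
  have hn0 : n ≠ 0 := by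
    rintro rfl
    exact hpq (h0.symm.trans hn)
  have hfz : ∀ i ≤ n, f i ≠ z := by
    intro i hi
    by_cases h : i = n
    · rw [h, hn]; exact hq.ne'
    · exact (hf i (by omega)).2.1
  refine tree_no_cycle (G := G) (Y := Y) hφ (m := n + 2) (by omega)
    (f := fun i => if i = 0 ∨ i = n + 2 then z else f (i - 1)) ?_ ?_ (by simp)
  · intro i hi
    by_cases h1 : i = 0
    · subst h1
      simpa [h0] using hp
    · by_cases h2 : i = n + 1
      · subst h2
        simpa [hn] using hq.symm
      · have := (hf (i - 1) (by omega)).1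
        have e : i - 1 + 1 = i := by omega
        rw [e] at this
        have h3 : i ≠ n + 2 := by omega
        simpa [h1, h2, h3] using this
  · intro i hi j hj hij
    have hi' : i < n + 2 := hi
    have hj' : j < n + 2 := hj
    simp only [hi'.ne, hj'.ne, or_false] at hij
    by_cases h1 : i = 0 <;> by_cases h2 : j = 0
    · omega
    · simp only [h1, h2, if_true, if_false] at hij
      exact absurd hij.symm (hfz _ (by omega))
    · simp only [h1, h2, if_true, if_false] at hij
      exact absurd hij (hfz _ (by omega))
    · simp only [h1, h2, if_false] at hij
      have := hinj (show i - 1 ≤ n by omega) (show j - 1 ≤ n by omega) hij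
      omega

lemma Tame.tree_spans (hY : Tame G d Y) (hv : v ∈ Y) (hvw : G.Adj v w) :
    Relation.ReflTransGen (tree G Y φ).Adj v w := by
  obtain ⟨B, hBY, hBf, hvB, hwB, hB⟩ := hY.exists_block hv hvw
  have key : ∀ n : ℕ, ∀ a ∈ B, ∀ b ∈ B, G.Adj a b →
      {t : X × X | t ∈ B ×ˢ B ∧ lab φ t.1 t.2 < lab φ a b}.ncard = n →
      Relation.ReflTransGen (tree G Y φ).Adj a b := by
    intro n
    induction n using Nat.strong_induction_on with
    | _ n ih =>
      intro a ha b hb hab hn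
      by_cases hT : (tree G Y φ).Adj a b
      · exact Relation.ReflTransGen.single hT
      have hrel : Relation.ReflTransGen (fun a' b' => G.Adj a' b' ∧ lab φ a' b' < lab φ a b) a b := by
        by_contra hc
        exact hT ⟨hab, hBY ha, hBY hb, hc⟩
      obtain ⟨m, f, h0, hm, hf, hinj⟩ := exists_injOn_path hrel
      have hsub : f '' Set.Iic m ⊆ B := by
        refine hB _ ((Set.finite_Iic m).image f)
          (bicon_cycle (fun i hi => (hf i hi).1) hinj (by rw [h0, hm]; exact hab.symm))
          a ⟨0, Nat.zero_le _, h0⟩ b ⟨m, le_refl m, hm⟩ hab.ne ha hb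
      have hstep : ∀ i < m, Relation.ReflTransGen (tree G Y φ).Adj (f i) (f (i + 1)) := by
        intro i hi
        have hiB := hsub ⟨i, hi.le, rfl⟩
        have hiB' := hsub ⟨i + 1, hi, rfl⟩
        refine ih _ ?_ _ hiB _ hiB' (hf i hi).1 rfl
        rw [← hn]
        refine Set.ncard_lt_ncard ⟨fun t ht => ⟨ht.1, ht.2.trans (hf i hi).2⟩, fun hs => ?_⟩
          ((hBf.prod hBf).subset fun t ht => ht.1)
        have := @hs (f i, f (i + 1)) ⟨⟨hiB, hiB'⟩, (hf i hi).2⟩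
        exact lt_irrefl _ this.2
      have hall : ∀ i ≤ m, Relation.ReflTransGen (tree G Y φ).Adj (f 0) (f i) := by
        intro i
        induction i with
        | zero => exact fun _ => Relation.ReflTransGen.refl
        | succ i ihi => exact fun hi => (ihi (by omega)).trans (hstep i hi)
      have := hall m le_rfl
      rwa [h0, hm] at this
  exact key _ v hvB w hwB hvw rfl

/-- Every vertex has two forest neighbors which it separates in `G`. -/
lemma Tame.tree_two (hY : Tame G d Y) (hv : v ∈ Y) :
    ∃ p q, (tree G Y φ).Adj v p ∧ (tree G Y φ).Adj v q ∧ ¬ Joined G {v}ᶜ p q := by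
  obtain ⟨u, w, hu, hw, hsep⟩ := hY.exists_separated hv
  have main : ∀ u, G.Adj v u → ∃ z, (tree G Y φ).Adj v z ∧ Joined G {v}ᶜ z u := by
    intro u hu
    obtain ⟨z, h1, h2, h3⟩ := exists_first_step (hY.tree_spans (φ := φ) hv hu) hu.ne'
    exact ⟨z, h1, Relation.ReflTransGen.mono (fun _ _ h => ⟨h.1.1, h.2.1, h.2.2⟩) _ _ h3⟩
  obtain ⟨p, hp, hpu⟩ := main u hu
  obtain ⟨q, hq, hqw⟩ := main w hw
  exact ⟨p, q, hp, hq, fun h => hsep (hpu.symm.trans (h.trans hqw))⟩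

lemma eq_or_eq_of_not_deg3 {T : SimpleGraph X} (h : ¬ Deg3 T U v) (ha : T.Adj v a) (haU : a ∈ U)
    (hb : T.Adj v b) (hbU : b ∈ U) (hab : a ≠ b) (hc : T.Adj v c) (hcU : c ∈ U) :
    c = a ∨ c = b := by
  by_contra! hne
  exact h ⟨a, b, c, hab, hne.1.symm, hne.2.symm, ⟨ha, haU⟩, ⟨hb, hbU⟩, hc, hcU⟩

/-- One of three consecutive vertices of the forest branches. -/
lemma Tame.tree_branch (hY : Tame G d Y) (h1 : (tree G Y φ).Adj v p) (h2 : (tree G Y φ).Adj v q)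
    (hpq : p ≠ q) :
    Deg3 (tree G Y φ) Y p ∨ Deg3 (tree G Y φ) Y v ∨ Deg3 (tree G Y φ) Y q := by
  by_contra! hcon
  obtain ⟨c1, c2, c3⟩ := hcon
  have hv : v ∈ Y := h1.2.1
  have hd := hY.three_le
  obtain ⟨w, hvw, hw⟩ : ∃ w ∈ G.neighborSet v, w ∉ ({p, q} : Set X) := by
    apply Set.exists_mem_notMem_of_ncard_lt_ncard
    · rw [hY.deg v hv, Set.ncard_pair hpq]
      omega
    · exact Set.toFinite _
  obtain ⟨z, hvz, hzv, hzw⟩ := exists_first_step (hY.tree_spans (φ := φ) hv hvw) hvw.ne'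
  have hz : z = p ∨ z = q := eq_or_eq_of_not_deg3 c2 h1 h1.2.2.1 h2 h2.2.2.1 hpq hvz hvz.2.2.1
  have hz3 : ¬ Deg3 (tree G Y φ) Y z := by
    rcases hz with rfl | rfl
    exacts [c1, c3]
  have hwz : w ≠ z := by
    rintro rfl
    exact hw (by simpa using hz)
  obtain ⟨b, ⟨hzb, -, hbv⟩, hbz, hbw⟩ := exists_first_step hzw hwz
  have hbw' : Joined G {z}ᶜ b w :=
    Relation.ReflTransGen.mono (fun _ _ h => ⟨h.1.1.1, h.2.1, h.2.2⟩) _ _ hbw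
  have hbv' : Joined G {z}ᶜ b v := hbw'.trans (Joined.single (SimpleGraph.Adj.symm hvw) hwz (Ne.symm hzv))
  obtain ⟨s, t, hs, ht, hst⟩ := hY.tree_two (φ := φ) (v := z) hvz.2.2.1
  have hne : s ≠ t := by
    rintro rfl
    exact hst Joined.refl
  have hb' := eq_or_eq_of_not_deg3 hz3 hs hs.2.2.1 ht ht.2.2.1 hne hzb hzb.2.2.1
  have hv' := eq_or_eq_of_not_deg3 hz3 hs hs.2.2.1 ht ht.2.2.1 hne hvz.symm hv
  rcases hb' with rfl | rfl <;> rcases hv' with rfl | rfl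
  · exact hbv rfl
  · exact hst hbv'
  · exact hst hbv'.symm
  · exact hbv rfl

end Tree

/-- `x` and `y` are joined by a walk of length at most `r`. -/
def Near {X : Type*} (G : SimpleGraph X) (r : ℕ) (x y : X) : Prop :=
  ∃ w : G.Walk x y, w.length ≤ r

/-- Distinct points of `A` have distance more than `r`. -/
def Discrete {X : Type*} (G : SimpleGraph X) (r : ℕ) (A : Set X) : Prop :=
  ∀ x ∈ A, ∀ y ∈ A, Near G r x y → x = y

/-- Every vertex of `T` in `U` has two neighbors in `U`, and every path of length `L` in `U`
has a branching vertex. -/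
def Bushy {X : Type*} (T : SimpleGraph X) (L : ℕ) (U : Set X) : Prop :=
  (∀ v ∈ U, ∃ a b, a ≠ b ∧ (T.Adj v a ∧ a ∈ U) ∧ T.Adj v b ∧ b ∈ U) ∧
  ∀ p : ℕ → X, (∀ i < L, T.Adj (p i) (p (i + 1))) → (∀ i ≤ L, p i ∈ U) →
    Set.InjOn p (Set.Iic L) → ∃ i ≤ L, Deg3 T U (p i)

/-- The point `x` together with the non-branching arms emanating from it. -/
def Arm {X : Type*} (T : SimpleGraph X) (U : Set X) (x : X) : Set X :=
  {z | Relation.ReflTransGen (fun a b => T.Adj a b ∧ b ∈ U ∧ ¬ Deg3 T U b) x z}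

/-- The set `U` after removing the arms around the points of `A`. -/
def Trim {X : Type*} (T : SimpleGraph X) (A U : Set X) : Set X :=
  {z | z ∈ U ∧ ¬ ∃ x, (x ∈ A ∧ x ∈ U) ∧ z ∈ Arm T U x}

section Trim

variable {X : Type*} {G T : SimpleGraph X} {L r s : ℕ} {A U : Set X} {a b c v w x y z p q : X}

lemma Near.trans (h : Near G r x y) (h' : Near G s y z) : Near G (r + s) x z := by
  obtain ⟨w, hw⟩ := h
  obtain ⟨w', hw'⟩ := h'
  exact ⟨w.append w', by rw [SimpleGraph.Walk.length_append]; omega⟩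

lemma Near.symm (h : Near G r x y) : Near G r y x := by
  obtain ⟨w, hw⟩ := h
  exact ⟨w.reverse, by rwa [SimpleGraph.Walk.length_reverse]⟩

lemma Near.mono (hrs : r ≤ s) (h : Near G r x y) : Near G s x y :=
  h.imp fun _ h => h.trans hrs

lemma near_one (h : G.Adj x y) : Near G 1 x y := ⟨h.toWalk, by simp⟩

lemma near_path {f : ℕ → X} {i j : ℕ} (hij : i ≤ j)
    (h : ∀ k, i ≤ k → k < j → G.Adj (f k) (f (k + 1))) : Near G (j - i) (f i) (f j) := by
  induction j, hij using Nat.le_induction with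
  | base => exact ⟨SimpleGraph.Walk.nil, by simp⟩
  | succ j hij ih =>
    exact ((ih fun k h1 h2 => h k h1 (by omega)).trans (near_one (h j hij (by omega)))).mono
      (by omega)

lemma arm_subset (hx : x ∈ U) : Arm T U x ⊆ U := by
  intro z hz
  cases hz with
  | refl => exact hx
  | tail _ h => exact h.2.1

lemma not_deg3_of_mem_arm (hz : z ∈ Arm T U x) (hzx : z ≠ x) : ¬ Deg3 T U z := by
  cases hz with
  | refl => exact absurd rfl hzx
  | tail _ h => exact h.2.2

lemma joined_arm (hz : z ∈ Arm T U x) : Joined T (Arm T U x) x z := by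
  induction hz with
  | refl => exact Joined.refl
  | tail h h' ih => exact ih.trans (Joined.single h'.1 h (h.tail h'))

lemma joined_arm' (hy : y ∈ Arm T U x) (hz : z ∈ Arm T U x) : Joined T (Arm T U x) y z :=
  (joined_arm hy).symm.trans (joined_arm hz)

lemma Bushy.no_arm_path (hB : Bushy T L U) {f : ℕ → X} (h0 : f 0 = x)
    (hf : ∀ i < L + 1, T.Adj (f i) (f (i + 1)))
    (hmem : ∀ i ≤ L + 1, f i ∈ Arm T U x) (hx : x ∈ U)
    (hinj : Set.InjOn f (Set.Iic (L + 1))) : False := by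
  obtain ⟨i, hi, h3⟩ := hB.2 (fun i => f (i + 1)) (fun i hi => hf (i + 1) (by omega))
    (fun i hi => arm_subset hx (hmem _ (by omega))) (fun i hi j hj hij => by
      have hi' : i ≤ L := hi
      have hj' : j ≤ L := hj
      have := hinj (show i + 1 ≤ L + 1 by omega) (show j + 1 ≤ L + 1 by omega) hij
      omega)
  refine not_deg3_of_mem_arm (hmem (i + 1) (by omega)) (fun h => ?_) h3
  have := hinj (show i + 1 ≤ L + 1 by omega) (show 0 ≤ L + 1 by omega) (h.trans h0.symm)
  omega

lemma Bushy.near_of_mem_arm (hB : Bushy T L U) (hTG : T ≤ G) (hx : x ∈ U)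
    (hz : z ∈ Arm T U x) : Near G L x z := by
  obtain ⟨n, f, h0, hn, hf, hinj⟩ := exists_injOn_path hz
  have hmem : ∀ i ≤ n, f i ∈ Arm T U x := fun i hi => by
    have := rtg_segment (r := fun a b => T.Adj a b ∧ b ∈ U ∧ ¬ Deg3 T U b) (f := f)
      (Nat.zero_le i) fun k _ hk => hf k (by omega)
    rw [h0] at this
    exact this
  have hnL : n ≤ L := by
    by_contra hc
    exact hB.no_arm_path h0 (fun i hi => (hf i (by omega)).1) (fun i hi => hmem i (by omega)) hx
      (hinj.mono fun i hi => le_trans (show i ≤ L + 1 from hi) (by omega))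
  have := near_path (G := G) (f := f) (Nat.zero_le n) fun k _ hk => hTG (hf k hk).1
  rw [h0, hn] at this
  exact this.mono (by omega)

lemma exists_of_mem_of_notMem_trim (hz : z ∈ U) (hz' : z ∉ Trim T A U) :
    ∃ x, x ∈ A ∧ x ∈ U ∧ z ∈ Arm T U x := by
  by_contra! hc
  exact hz' ⟨hz, fun ⟨x, hx, h⟩ => hc x hx.1 hx.2 h⟩

lemma notMem_arm_of_mem_trim (hz : z ∈ Trim T A U) (hx : x ∈ A) (hxU : x ∈ U) :
    z ∉ Arm T U x := fun h => hz.2 ⟨x, ⟨hx, hxU⟩, h⟩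

variable (hTG : T ≤ G)
  (hsep : ∀ z p q, T.Adj z p → T.Adj z q → p ≠ q → ¬ Joined T {z}ᶜ p q)
  (hB : Bushy T L U) (hA : Discrete G (4 * L + 10) A)

include hsep hTG hB hA in
lemma removed_nbr_unique (hz : z ∈ Trim T A U) (hp : T.Adj z p) (hpU : p ∈ U)
    (hpU' : p ∉ Trim T A U) (hq : T.Adj z q) (hqU : q ∈ U) (hqU' : q ∉ Trim T A U) : p = q := by
  by_contra hpq
  obtain ⟨x, hxA, hxU, hpx⟩ := exists_of_mem_of_notMem_trim hpU hpU'
  obtain ⟨y, hyA, hyU, hqy⟩ := exists_of_mem_of_notMem_trim hqU hqU'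
  have hnear := (((hB.near_of_mem_arm hTG hxU hpx).trans (near_one (hTG hp.symm))).trans
    (near_one (hTG hq))).trans (hB.near_of_mem_arm hTG hyU hqy).symm
  obtain rfl := hA x hxA y hyA (hnear.mono (by omega))
  refine hsep z p q hp hq hpq ((joined_arm' hpx hqy).mono fun t ht htz => ?_)
  obtain rfl : t = z := htz
  exact notMem_arm_of_mem_trim hz hxA hxU ht

lemma deg3_of_removed_nbr (hz : z ∈ Trim T A U) (hp : T.Adj z p) (hpU : p ∈ U)
    (hpU' : p ∉ Trim T A U) : Deg3 T U z := by
  by_contra hc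
  obtain ⟨x, hxA, hxU, hpx⟩ := exists_of_mem_of_notMem_trim hpU hpU'
  exact notMem_arm_of_mem_trim hz hxA hxU (Relation.ReflTransGen.tail hpx ⟨hp.symm, hz.1, hc⟩)

lemma deg3_trim_or (h : Deg3 T U z) :
    Deg3 T (Trim T A U) z ∨ ∃ p, T.Adj z p ∧ p ∈ U ∧ p ∉ Trim T A U := by
  by_contra! hc
  obtain ⟨a, b, c, h1, h2, h3, ⟨ha, haU⟩, ⟨hb, hbU⟩, hc', hcU⟩ := h
  exact hc.1 ⟨a, b, c, h1, h2, h3, ⟨ha, hc.2 a ha haU⟩, ⟨hb, hc.2 b hb hbU⟩, hc', hc.2 c hc' hcU⟩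

include hsep hTG hB hA in
lemma Bushy.trim : Bushy T (2 * L + 1) (Trim T A U) := by
  refine ⟨fun z hz => ?_, fun f hf hfU hinj => ?_⟩
  · have huniq : ∀ p q, T.Adj z p → p ∈ U → p ∉ Trim T A U → T.Adj z q → q ∈ U → q ≠ p →
        q ∈ Trim T A U := fun p q h1 h2 h3 h4 h5 h6 => by
      by_contra hc
      exact h6 (removed_nbr_unique hTG hsep hB hA hz h4 h5 hc h1 h2 h3)
    by_cases hrem : ∃ p, T.Adj z p ∧ p ∈ U ∧ p ∉ Trim T A U
    · obtain ⟨p, hp, hpU, hpU'⟩ := hrem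
      obtain ⟨a, b, c, h1, h2, h3, ⟨ha, haU⟩, ⟨hb, hbU⟩, hc, hcU⟩ :=
        deg3_of_removed_nbr hz hp hpU hpU'
      have k := huniq p
      by_cases hap : a = p
      · subst hap
        exact ⟨b, c, h3, ⟨hb, huniq _ _ hp hpU hpU' hb hbU h1.symm⟩, hc,
          huniq _ _ hp hpU hpU' hc hcU h2.symm⟩
      · by_cases hbp : b = p
        · subst hbp
          exact ⟨a, c, h2, ⟨ha, huniq _ _ hp hpU hpU' ha haU h1⟩, hc,
            huniq _ _ hp hpU hpU' hc hcU h3.symm⟩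
        · exact ⟨a, b, h1, ⟨ha, huniq _ _ hp hpU hpU' ha haU hap⟩, hb,
            huniq _ _ hp hpU hpU' hb hbU hbp⟩
    · push Not at hrem
      obtain ⟨a, b, h1, ⟨ha, haU⟩, hb, hbU⟩ := hB.1 z hz.1
      exact ⟨a, b, h1, ⟨ha, hrem a ha haU⟩, hb, hrem b hb hbU⟩
  · by_contra! hno
    obtain ⟨i, hi, hi3⟩ := hB.2 f (fun i hi => hf i (by omega)) (fun i hi => (hfU i (by omega)).1)
      (hinj.mono fun i hi => le_trans (show i ≤ L from hi) (by omega))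
    obtain ⟨j', hj', hj3⟩ := hB.2 (fun i => f (i + (L + 1)))
      (fun i hi => by
        have := hf (i + (L + 1)) (by omega)
        rwa [show i + (L + 1) + 1 = i + 1 + (L + 1) by omega] at this)
      (fun i hi => (hfU _ (by omega)).1)
      (fun i hi k hk hik => by
        have hi' : i ≤ L := hi
        have hk' : k ≤ L := hk
        have := hinj (show i + (L + 1) ≤ 2 * L + 1 by omega)
          (show k + (L + 1) ≤ 2 * L + 1 by omega) hik
        omega)
    have hj : ∃ j, j = j' + (L + 1) := ⟨_, rfl⟩
    obtain ⟨j, hj⟩ := hj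
    rw [← hj] at hj3
    obtain ⟨a, hia, haU, haU'⟩ := (deg3_trim_or (A := A) hi3).resolve_left (hno i (by omega))
    obtain ⟨b, hjb, hbU, hbU'⟩ := (deg3_trim_or (A := A) hj3).resolve_left (hno j (by omega))
    obtain ⟨x, hxA, hxU, hax⟩ := exists_of_mem_of_notMem_trim haU haU'
    obtain ⟨y, hyA, hyU, hby⟩ := exists_of_mem_of_notMem_trim hbU hbU'
    have hnear := ((((hB.near_of_mem_arm hTG hxU hax).trans (near_one (hTG hia.symm))).trans
      (near_path (f := f) (show i ≤ j by omega) fun k _ hk => hTG (hf k (by omega)))).trans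
      (near_one (hTG hjb))).trans (hB.near_of_mem_arm hTG hyU hby).symm
    obtain rfl := hA x hxA y hyA (hnear.mono (by omega))
    have hfi : ∀ t ∈ Arm T U x, t ≠ f i := fun t ht h => by
      subst h
      exact notMem_arm_of_mem_trim (hfU i (by omega)) hxA hxU ht
    have hfk : ∀ k, i + 1 ≤ k → k ≤ j → f k ∈ ({f i}ᶜ : Set X) := fun k h1 h2 h => by
      have := hinj (show k ≤ 2 * L + 1 by omega) (show i ≤ 2 * L + 1 by omega) h
      omega
    refine hsep (f i) a (f (i + 1)) hia (hf i (by omega))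
      (fun h => haU' (h ▸ hfU (i + 1) (by omega))) ?_
    have s1 : Joined T {f i}ᶜ a b := (joined_arm' hax hby).mono hfi
    have s2 : Joined T {f i}ᶜ b (f j) :=
      Joined.single hjb.symm (hfi b hby) (hfk j (by omega) le_rfl)
    have s3 : Joined T {f i}ᶜ (f (i + 1)) (f j) :=
      rtg_segment (f := f) (show i + 1 ≤ j by omega) fun k h1 h2 =>
        ⟨hf k (by omega), hfk k h1 (by omega), hfk (k + 1) (by omega) (by omega)⟩
    exact s1.trans (s2.trans s3.symm)

include hsep hTG hB hA in
lemma Bushy.exists_joined_trim (hx : x ∈ U) : ∃ y ∈ Trim T A U, Joined G U x y := by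
  have up : ∀ {u v}, Joined T U u v → Joined G U u v := fun h =>
    Relation.ReflTransGen.mono (fun _ _ h => ⟨hTG h.1, h.2⟩) _ _ h
  by_cases hxt : x ∈ Trim T A U
  · exact ⟨x, hxt, Joined.refl⟩
  obtain ⟨c, hcA, hcU, hxc⟩ := exists_of_mem_of_notMem_trim hx hxt
  by_cases hout : ∃ z ∈ Arm T U c, ∃ y ∈ Trim T A U, T.Adj z y
  · obtain ⟨z, hz, y, hy, hzy⟩ := hout
    have : Joined T U x z := (joined_arm' hxc hz).mono (arm_subset hcU)
    exact ⟨y, hy, up (this.trans (Joined.single hzy (arm_subset hcU hz) hy.1))⟩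
  exfalso
  push Not at hout
  have hclosed : ∀ z ∈ Arm T U c, ∀ y ∈ U, T.Adj z y → y ∈ Arm T U c := by
    intro z hz y hy hzy
    obtain ⟨c', hcA', hcU', hyc⟩ :=
      exists_of_mem_of_notMem_trim (A := A) hy fun h => hout z hz y h hzy
    have hnear := ((hB.near_of_mem_arm hTG hcU hz).trans (near_one (hTG hzy))).trans
      (hB.near_of_mem_arm hTG hcU' hyc).symm
    obtain rfl := hA c hcA c' hcA' (hnear.mono (by omega))
    exact hyc
  have hpath : ∀ n, ∃ f : ℕ → X, f 0 = c ∧ (∀ i < n, T.Adj (f i) (f (i + 1))) ∧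
      (∀ i ≤ n, f i ∈ Arm T U c) ∧ Set.InjOn f (Set.Iic n) := by
    intro n
    induction n with
    | zero =>
      refine ⟨fun _ => c, rfl, by simp, fun _ _ => Relation.ReflTransGen.refl, ?_⟩
      intro i hi j hj _
      have hi' : i ≤ 0 := hi
      have hj' : j ≤ 0 := hj
      omega
    | succ n ih =>
      obtain ⟨f, h0, hf, hmem, hinj⟩ := ih
      obtain ⟨a, ha, haU, hane⟩ : ∃ a, T.Adj (f n) a ∧ a ∈ U ∧ a ≠ f (n - 1) := by
        obtain ⟨a, b, hab, ⟨ha, haU⟩, hb, hbU⟩ := hB.1 (f n) (arm_subset hcU (hmem n le_rfl))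
        by_cases h : a = f (n - 1)
        · exact ⟨b, hb, hbU, fun h' => hab (h.trans h'.symm)⟩
        · exact ⟨a, ha, haU, h⟩
      have hnew : ∀ i ≤ n, f i ≠ a := by
        intro i hi h
        by_cases hin : i = n
        · subst hin
          exact ha.ne h
        have hne : i ≠ n - 1 := fun h' => hane (by rw [← h, h'])
        have hlast := hf (n - 1) (by omega)
        rw [show n - 1 + 1 = n by omega] at hlast
        refine hsep (f n) a (f (n - 1)) ha hlast.symm hane ?_
        rw [← h]
        have hk : ∀ k, k < n → f k ∈ ({f n}ᶜ : Set X) := fun k hk h => by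
          have := hinj (show k ≤ n by omega) (show n ≤ n from le_rfl) h
          omega
        exact rtg_segment (f := f) (show i ≤ n - 1 by omega) fun k h1 h2 =>
          ⟨hf k (by omega), hk k (by omega), hk (k + 1) (by omega)⟩
      refine ⟨fun i => if i ≤ n then f i else a, by simp [h0], fun i hi => ?_, fun i hi => ?_, ?_⟩
      · by_cases h : i < n
        · simpa [h.le, Nat.succ_le_of_lt h] using hf i h
        · obtain rfl : i = n := by omega
          simpa using ha
      · by_cases h : i ≤ n
        · simpa [h] using hmem i h
        · simpa [h] using hclosed _ (hmem n le_rfl) a haU ha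
      · intro i hi j hj hij
        have hi' : i ≤ n + 1 := hi
        have hj' : j ≤ n + 1 := hj
        by_cases h1 : i ≤ n <;> by_cases h2 : j ≤ n <;> simp only [h1, h2, if_true, if_false] at hij
        · exact hinj h1 h2 hij
        · exact absurd hij (hnew i h1)
        · exact absurd hij.symm (hnew j h2)
        · omega
  obtain ⟨f, h0, hf, hmem, hinj⟩ := hpath (L + 1)
  exact hB.no_arm_path h0 hf hmem hcU hinj

end Trim

lemma Tame.bushy {X : Type*} {G : SimpleGraph X} {d : ℕ} {Y : Set X} {φ : X → ℝ}
    (hY : Tame G d Y) : Bushy (tree G Y φ) 2 Y := by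
  refine ⟨fun v hv => ?_, fun p hp hpY hinj => ?_⟩
  · obtain ⟨a, b, ha, hb, hab⟩ := hY.tree_two (φ := φ) hv
    refine ⟨a, b, ?_, ⟨ha, ha.2.2.1⟩, hb, hb.2.2.1⟩
    rintro rfl
    exact hab Joined.refl
  · have h02 : p 0 ≠ p 2 := fun h => by
      have := hinj (show 0 ≤ 2 by omega) (show 2 ≤ 2 by omega) h
      omega
    rcases hY.tree_branch (hp 0 (by omega)).symm (hp 1 (by omega)) h02 with h | h | h
    exacts [⟨0, by omega, h⟩, ⟨1, by omega, h⟩, ⟨2, by omega, h⟩]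

/-- A locally finite graph whose connectedness relation is enumerated by countably many
measurable functions of bounded displacement. -/
structure Sys {X : Type*} [MeasurableSpace X] (G : SimpleGraph X) (g : ℕ → X → X) (φ : X → ℝ) :
    Prop where
  meas_g : ∀ n, Measurable (g n)
  reach : ∀ x y, G.Reachable x y → ∃ n, g n x = y
  len : ∀ n, ∃ l, ∀ x, Near G l x (g n x)
  meas_adj : ∀ n, Measurable fun x => G.Adj x (g n x)
  meas_φ : Measurable φ
  inj_φ : Function.Injective φ
  fin : ∀ x, (G.neighborSet x).Finite

section Measurability

variable {X : Type*} [MeasurableSpace X] {G : SimpleGraph X} {g : ℕ → X → X} {φ : X → ℝ}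
  {α : Type*} [MeasurableSpace α] {f h : α → X}

omit [MeasurableSpace X] in
lemma Near.reachable {r : ℕ} {x y : X} (hxy : Near G r x y) : G.Reachable x y :=
  let ⟨w, _⟩ := hxy; ⟨w⟩

omit [MeasurableSpace X] in
lemma Joined.reachable {S : Set X} {x y : X} (hxy : Joined G S x y) : G.Reachable x y := by
  induction hxy with
  | refl => exact SimpleGraph.Reachable.refl _
  | tail _ h ih => exact ih.trans h.1.reachable

lemma measurable_sInf_nat {P : ℕ → α → Prop} (hP : ∀ n, Measurable (P n)) :
    Measurable fun a => sInf {n | P n a} := by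
  refine measurable_to_countable' fun k => ?_
  have : (fun a => sInf {n | P n a}) ⁻¹' {k} =
      {a | (P k a ∧ ∀ j, j < k → ¬ P j a) ∨ (k = 0 ∧ ∀ j, ¬ P j a)} := by
    ext a
    simp only [Set.mem_preimage, Set.mem_singleton_iff, Set.mem_ofPred_eq]
    constructor
    · rintro rfl
      by_cases hne : {n | P n a}.Nonempty
      · exact Or.inl ⟨Nat.sInf_mem hne, fun j hj hPj => Nat.notMem_of_lt_sInf hj hPj⟩
      · rw [Set.not_nonempty_iff_eq_empty] at hne
        refine Or.inr ⟨by rw [hne, Nat.sInf_empty], fun j hj => ?_⟩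
        have : j ∈ {n | P n a} := hj
        rw [hne] at this
        exact this
    · rintro (⟨h1, h2⟩ | ⟨rfl, h2⟩)
      · exact le_antisymm (Nat.sInf_le h1) (le_of_not_gt fun hlt =>
          h2 _ hlt (Nat.sInf_mem (s := {n | P n a}) ⟨k, h1⟩))
      · have : {n | P n a} = ∅ := Set.eq_empty_of_forall_notMem h2
        rw [this, Nat.sInf_empty]
  rw [this, measurableSet_setOfPred]
  exact ((hP k).and (Measurable.forall fun j => Measurable.imp measurable_const (hP j).not)).or
    (Measurable.and measurable_const (Measurable.forall fun j => (hP j).not))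

/-- Measurable choice from a countable set. -/
lemma exists_measurable_choice {ι : Type*} [Countable ι] [Nonempty ι] {P : ι → α → Prop}
    (hP : ∀ i, Measurable (P i)) :
    ∃ F : α → ι, (∀ i, Measurable fun a => F a = i) ∧ ∀ a, (∃ i, P i a) → P (F a) a := by
  obtain ⟨s, hs⟩ := exists_surjective_nat ι
  have hm := measurable_sInf_nat fun n => hP (s n)
  refine ⟨fun a => s (sInf {n | P (s n) a}), fun i => ?_, fun a ⟨i, hi⟩ => ?_⟩
  · have : (fun a => s (sInf {n | P (s n) a}) = i) =
        fun a => ∃ n, sInf {n | P (s n) a} = n ∧ s n = i := by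
      ext a; simp
    rw [this]
    exact Measurable.exists fun n =>
      (measurableSet_setOfPred.1 (hm (measurableSet_singleton n))).and measurable_const
  · obtain ⟨n, rfl⟩ := hs i
    exact Nat.sInf_mem (s := {n | P (s n) a}) ⟨n, hi⟩

variable (hs : Sys G g φ)

include hs

lemma Sys.reachable (n : ℕ) (x : X) : G.Reachable x (g n x) :=
  let ⟨_, h⟩ := hs.len n; (h x).reachable

lemma Sys.eq (hf : Measurable f) (hh : Measurable h) : Measurable fun a => f a = h a := by
  have : (fun a => f a = h a) = fun a => φ (f a) = φ (h a) := by
    ext a; exact hs.inj_φ.eq_iff.symm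
  rw [this]
  exact measurableSet_setOfPred.1
    (measurableSet_eq_fun (hs.meas_φ.comp hf) (hs.meas_φ.comp hh))

lemma Sys.adj (hf : Measurable f) (hh : Measurable h) : Measurable fun a => G.Adj (f a) (h a) := by
  have : (fun a => G.Adj (f a) (h a)) =
      fun a => ∃ n, g n (f a) = h a ∧ G.Adj (f a) (g n (f a)) := by
    ext a
    constructor
    · intro hadj
      obtain ⟨n, hn⟩ := hs.reach _ _ hadj.reachable
      exact ⟨n, hn, hn ▸ hadj⟩
    · rintro ⟨n, hn, hadj⟩
      exact hn ▸ hadj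
  rw [this]
  exact Measurable.exists fun n => (hs.eq ((hs.meas_g n).comp hf) hh).and ((hs.meas_adj n).comp hf)

/-- Quantification over the points of a component is measurable. -/
lemma Sys.ex {P : α → X → Prop} (hP : Measurable fun q : α × X => P q.1 q.2) (hf : Measurable f)
    (hreach : ∀ a z, P a z → G.Reachable (f a) z) : Measurable fun a => ∃ z, P a z := by
  have : (fun a => ∃ z, P a z) = fun a => ∃ n, P a (g n (f a)) := by
    ext a
    constructor
    · rintro ⟨z, hz⟩
      obtain ⟨n, rfl⟩ := hs.reach _ _ (hreach a z hz)
      exact ⟨n, hz⟩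
    · rintro ⟨n, hn⟩
      exact ⟨_, hn⟩
  rw [this]
  exact Measurable.exists fun n => hP.comp (measurable_id.prodMk ((hs.meas_g n).comp hf))

lemma Sys.rtg {R : α → X → X → Prop} (hR : Measurable fun q : α × X × X => R q.1 q.2.1 q.2.2)
    (hreach : ∀ a x y, R a x y → G.Reachable x y) :
    Measurable fun q : α × X × X => Relation.ReflTransGen (R q.1) q.2.1 q.2.2 := by
  let I : ℕ → α → X → X → Prop := fun n a => Nat.rec (fun x y => x = y)
    (fun _ r x y => ∃ z, r x z ∧ R a z y) n
  have hI : ∀ n a x y, I n a x y → G.Reachable x y := by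
    intro n a
    induction n with
    | zero => rintro x _ rfl; exact SimpleGraph.Reachable.refl _
    | succ n ih => rintro x y ⟨z, h1, h2⟩; exact (ih x z h1).trans (hreach a z y h2)
  have hIm : ∀ n, Measurable fun q : α × X × X => I n q.1 q.2.1 q.2.2 := by
    intro n
    induction n with
    | zero => exact hs.eq (by fun_prop) (by fun_prop)
    | succ n ih =>
      refine hs.ex (f := fun q : α × X × X => q.2.1)
        (P := fun q z => I n q.1 q.2.1 z ∧ R q.1 z q.2.2) ?_ (by fun_prop)
        fun a z hz => hI n _ _ _ hz.1
      exact (ih.comp (by fun_prop : Measurable fun t : (α × X × X) × X => (t.1.1, t.1.2.1, t.2))).and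
        (hR.comp (by fun_prop : Measurable fun t : (α × X × X) × X => (t.1.1, t.2, t.1.2.2)))
  have : (fun q : α × X × X => Relation.ReflTransGen (R q.1) q.2.1 q.2.2) =
      fun q => ∃ n, I n q.1 q.2.1 q.2.2 := by
    ext ⟨a, x, y⟩
    dsimp only
    constructor
    · intro hxy
      induction hxy with
      | refl => exact ⟨0, rfl⟩
      | tail _ h ih =>
        obtain ⟨n, hn⟩ := ih
        exact ⟨n + 1, _, hn, h⟩
    · rintro ⟨n, hn⟩
      induction n generalizing y with
      | zero => obtain rfl : x = y := hn; exact Relation.ReflTransGen.refl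
      | succ n ih => obtain ⟨z, h1, h2⟩ := hn; exact (ih z h1).tail h2
  rw [this]
  exact Measurable.exists hIm

lemma Sys.rtg' {R : X → X → Prop} (hR : Measurable fun q : X × X => R q.1 q.2)
    (hreach : ∀ x y, R x y → G.Reachable x y) (hf : Measurable f) (hh : Measurable h) :
    Measurable fun a => Relation.ReflTransGen R (f a) (h a) := by
  have := hs.rtg (R := fun _ : Unit => R)
    (hR.comp (by fun_prop : Measurable fun q : Unit × X × X => (q.2.1, q.2.2)))
    fun _ x y h => hreach x y h
  exact this.comp (measurable_const.prodMk (hf.prodMk hh) : Measurable fun a => ((), f a, h a))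

lemma Sys.near (r : ℕ) (hf : Measurable f) (hh : Measurable h) :
    Measurable fun a => Near G r (f a) (h a) := by
  have key : Measurable fun q : X × X => Near G r q.1 q.2 := by
    induction r with
    | zero =>
      have : (fun q : X × X => Near G 0 q.1 q.2) = fun q => q.1 = q.2 := by
        ext ⟨x, y⟩
        dsimp only
        constructor
        · rintro ⟨w, hw⟩
          exact SimpleGraph.Walk.eq_of_length_eq_zero (Nat.le_zero.1 hw)
        · rintro rfl
          exact ⟨SimpleGraph.Walk.nil, by simp⟩
      rw [this]
      exact hs.eq (by fun_prop) (by fun_prop)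
    | succ r ih =>
      have : (fun q : X × X => Near G (r + 1) q.1 q.2) =
          fun q => q.1 = q.2 ∨ ∃ z, G.Adj q.1 z ∧ Near G r z q.2 := by
        ext ⟨x, y⟩
        dsimp only
        constructor
        · rintro ⟨w, hw⟩
          cases w with
          | nil => exact Or.inl rfl
          | cons hadj w => exact Or.inr ⟨_, hadj, w, by simpa using hw⟩
        · rintro (rfl | ⟨z, h1, h2⟩)
          · exact ⟨SimpleGraph.Walk.nil, by simp⟩
          · exact ((near_one h1).trans h2).mono (by omega)
      rw [this]
      refine (hs.eq (by fun_prop) (by fun_prop)).or (hs.ex (f := Prod.fst) ?_ (by fun_prop)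
        fun q z hz => hz.1.reachable)
      exact (hs.adj (by fun_prop) (by fun_prop)).and
        (ih.comp (by fun_prop : Measurable fun t : (X × X) × X => (t.2, t.1.2)))
  exact key.comp (hf.prodMk hh)

/-- Counting points in a component is measurable. -/
lemma Sys.le_encard {P : α → X → Prop} (hP : Measurable fun q : α × X => P q.1 q.2)
    (hf : Measurable f) (hreach : ∀ a z, P a z → G.Reachable (f a) z) (m : ℕ) :
    Measurable fun a => (m : ℕ∞) ≤ {z | P a z}.encard := by
  have : (fun a => (m : ℕ∞) ≤ {z | P a z}.encard) = fun a => ∃ σ : Fin m → ℕ,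
      (∀ i j, i ≠ j → ¬ g (σ i) (f a) = g (σ j) (f a)) ∧ ∀ i, P a (g (σ i) (f a)) := by
    ext a
    constructor
    · intro hm
      obtain ⟨t, ht, htm⟩ := Set.exists_subset_encard_eq hm
      have htf : t.Finite := Set.finite_of_encard_eq_coe htm
      have hcard : htf.toFinset.card = m := by
        rw [htf.encard_eq_coe_toFinset_card] at htm
        exact_mod_cast htm
      let e := htf.toFinset.equivFinOfCardEq hcard
      have hmem : ∀ i, P a (e.symm i : X) := fun i =>
        ht (htf.mem_toFinset.1 (e.symm i).2)
      choose σ hσ using fun i => hs.reach _ _ (hreach a _ (hmem i))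
      refine ⟨σ, fun i j hij heq => hij ?_, fun i => by rw [hσ]; exact hmem i⟩
      rw [hσ, hσ] at heq
      exact e.symm.injective (Subtype.ext heq)
    · rintro ⟨σ, h1, h2⟩
      have hinj : Function.Injective fun i => g (σ i) (f a) := fun i j hij => by
        by_contra hne
        exact h1 i j hne hij
      have hsub : Set.range (fun i => g (σ i) (f a)) ⊆ {z | P a z} := by
        rintro _ ⟨i, rfl⟩; exact h2 i
      refine le_trans ?_ (Set.encard_le_encard hsub)
      rw [← Set.image_univ, hinj.encard_image, Set.encard_univ]
      simp
  rw [this]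
  refine Measurable.exists fun σ => Measurable.and ?_ ?_
  · exact Measurable.forall fun i => Measurable.forall fun j => Measurable.imp measurable_const
      (hs.eq ((hs.meas_g _).comp hf) ((hs.meas_g _).comp hf)).not
  · exact Measurable.forall fun i => hP.comp (measurable_id.prodMk ((hs.meas_g _).comp hf))

omit [MeasurableSpace X] hs in
lemma near_finite (hfin : ∀ x, (G.neighborSet x).Finite) (r : ℕ) (x : X) :
    {y | Near G r x y}.Finite := by
  induction r generalizing x with
  | zero =>
    refine (Set.finite_singleton x).subset ?_
    rintro y ⟨w, hw⟩
    exact (SimpleGraph.Walk.eq_of_length_eq_zero (Nat.le_zero.1 hw)).symm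
  | succ r ih =>
    refine ((Set.finite_singleton x).union ((hfin x).biUnion fun z _ => ih z)).subset ?_
    rintro y ⟨w, hw⟩
    cases w with
    | nil => exact Or.inl rfl
    | cons hadj w =>
      refine Or.inr (Set.mem_biUnion (x := _) hadj ⟨w, by simpa using hw⟩)

/-- A countable measurable cover by sparse sets. -/
lemma Sys.exists_discrete_cover (r : ℕ) : ∃ V : ℕ → Set X, (∀ n, MeasurableSet (V n)) ∧
    (∀ n, Discrete G r (V n)) ∧ ⋃ n, V n = Set.univ := by
  obtain ⟨I, hI⟩ := (TopologicalSpace.countable_countableBasis ℝ).exists_eq_range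
    (((TopologicalSpace.isBasis_countableBasis ℝ).exists_subset_of_mem_open (Set.mem_univ (0 : ℝ))
      isOpen_univ).imp fun _ h => h.1)
  have hIo : ∀ n, IsOpen (I n) := fun n =>
    TopologicalSpace.isOpen_of_mem_countableBasis (hI ▸ ⟨n, rfl⟩)
  refine ⟨fun n => {x | φ x ∈ I n ∧ ¬ ∃ y, (Near G r x y ∧ ¬ x = y) ∧ φ y ∈ I n}, fun n => ?_,
    fun n x hx y hy hxy => ?_, Set.eq_univ_of_forall fun x => Set.mem_iUnion.2 ?_⟩
  · rw [measurableSet_setOfPred]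
    have hmem : Measurable fun x => φ x ∈ I n := (hIo n).measurableSet.mem.comp hs.meas_φ
    refine hmem.and (hs.ex (f := id) ?_ measurable_id fun a z hz => hz.1.1.reachable).not
    exact ((hs.near r (by fun_prop) (by fun_prop)).and
      (hs.eq (by fun_prop) (by fun_prop)).not).and (hmem.comp measurable_snd)
  · by_contra hne
    exact hx.2 ⟨y, ⟨hxy, hne⟩, hy.1⟩
  · set F := φ '' ({y | Near G r x y} \ {x}) with hF
    have hFf : F.Finite := ((near_finite hs.fin r x).subset Set.sdiff_subset).image φ
    have hxF : φ x ∈ Fᶜ := by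
      rintro ⟨y, hy, hyx⟩
      exact hy.2 (hs.inj_φ hyx)
    obtain ⟨o, ho, hxo, hoF⟩ := (TopologicalSpace.isBasis_countableBasis ℝ).exists_subset_of_mem_open
      hxF hFf.isClosed.isOpen_compl
    rw [hI] at ho
    obtain ⟨n, rfl⟩ := ho
    refine ⟨n, hxo, ?_⟩
    rintro ⟨y, ⟨h1, h2⟩, h3⟩
    exact hoF h3 ⟨y, ⟨h1, Ne.symm h2⟩, rfl⟩

end Measurability

section Greedy

variable {X : Type*} [MeasurableSpace X] {G : SimpleGraph X} {g : ℕ → X → X} {φ : X → ℝ}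
  {d : ℕ}

/-- Greedy coloring along a well-ordered key, each vertex having a neighbor colored later. -/
lemma Sys.greedy (hs : Sys G g φ) (hd : 0 < d) (hdeg : ∀ x, (G.neighborSet x).ncard ≤ d)
    {ι : Type*} [LinearOrder ι] [WellFoundedLT ι] [Countable ι] {key : X → ι}
    (hkey : ∀ k, Measurable fun x => key x = k) {B : Set X} (hB : MeasurableSet B)
    (hne : ∀ x ∈ B, ∀ y ∈ B, G.Adj x y → key x ≠ key y)
    (hup : ∀ x ∈ B, ∃ w, G.Adj x w ∧ (w ∈ B → key x < key w)) :
    ∃ c : X → Fin d, Measurable c ∧ ∀ x ∈ B, ∀ y ∈ B, G.Adj x y → c x ≠ c y := by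
  have hwf : WellFounded (InvImage (· < ·) key) := InvImage.wf key wellFounded_lt
  obtain ⟨c, hc⟩ : ∃ c : X → ℕ, ∀ x, c x =
      sInf {i | ¬ ∃ y, (key y < key x ∧ c y = i) ∧ y ∈ B ∧ G.Adj x y} := by
    refine ⟨hwf.fix fun x rec => sInf {i | ¬ ∃ y, (∃ h : key y < key x, rec y h = i) ∧
      y ∈ B ∧ G.Adj x y}, fun x => ?_⟩
    rw [hwf.fix_eq]
    simp only [exists_prop]
  have hmeas' : ∀ k i, Measurable fun x => key x = k ∧ c x = i := by
    intro k
    induction k using WellFoundedLT.induction with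
    | _ k ih =>
    intro i
    have hP : ∀ i, Measurable fun x => ¬ ∃ y, (∃ k' : Set.Iio k, key y = k' ∧ c y = i) ∧
        y ∈ B ∧ G.Adj x y := by
      intro i
      refine (hs.ex (f := id) ?_ measurable_id fun a z hz => hz.2.2.reachable).not
      refine Measurable.and (Measurable.exists fun k' => (ih k' k'.2 i).comp measurable_snd)
        ((hB.mem.comp measurable_snd).and (hs.adj (by fun_prop) (by fun_prop)))
    have hm := measurable_sInf_nat hP
    have : (fun x => key x = k ∧ c x = i) = fun x => key x = k ∧
        sInf {i | ¬ ∃ y, (∃ k' : Set.Iio k, key y = k' ∧ c y = i) ∧ y ∈ B ∧ G.Adj x y} = i := by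
      ext x
      refine and_congr_right fun hx => ?_
      rw [hc x]
      have : ∀ i, (¬ ∃ y, (key y < key x ∧ c y = i) ∧ y ∈ B ∧ G.Adj x y) ↔
          ¬ ∃ y, (∃ k' : Set.Iio k, key y = k' ∧ c y = i) ∧ y ∈ B ∧ G.Adj x y := by
        intro i
        refine not_congr (exists_congr fun y => and_congr_left fun _ => ?_)
        constructor
        · rintro ⟨h1, h2⟩
          exact ⟨⟨key y, hx ▸ h1⟩, rfl, h2⟩
        · rintro ⟨⟨k', hk'⟩, h1, h2⟩
          have hk'' : k' < k := hk'
          exact ⟨by rw [hx]; simpa [h1] using hk'', h2⟩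
      simp only [this]
    rw [this]
    exact (hkey k).and (measurableSet_setOfPred.1 (hm (measurableSet_singleton i)))
  have hmeas : Measurable c := by
    refine measurable_to_countable' fun i => ?_
    have : c ⁻¹' {i} = {x | ∃ k, key x = k ∧ c x = i} := by ext x; simp
    rw [this, measurableSet_setOfPred]
    exact Measurable.exists fun k => hmeas' k i
  have hlt : ∀ x ∈ B, ∃ i < d, ¬ ∃ y, (key y < key x ∧ c y = i) ∧ y ∈ B ∧ G.Adj x y := by
    intro x hx
    obtain ⟨w, hw, hwB⟩ := hup x hx
    have hfin := (hs.fin x).subset (Set.sdiff_subset (t := {w}))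
    obtain ⟨i, hi, hi'⟩ : ∃ i ∈ Set.Iio d, i ∉ c '' (G.neighborSet x \ {w}) := by
      apply Set.exists_mem_notMem_of_ncard_lt_ncard
      · have h1 := Set.ncard_image_le (f := c) hfin
        have h2 := Set.ncard_sdiff_singleton_add_one (show w ∈ G.neighborSet x from hw) (hs.fin x)
        have h3 := hdeg x
        have h4 : (Set.Iio d).ncard = d := by
          rw [← Finset.coe_Iio, Set.ncard_coe_finset, Nat.card_Iio]
        omega
      · exact hfin.image c
    refine ⟨i, hi, ?_⟩
    rintro ⟨y, ⟨h1, h2⟩, h3, h4⟩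
    refine hi' ⟨y, ⟨h4, ?_⟩, h2⟩
    rintro rfl
    exact lt_asymm h1 (hwB h3)
  have hcd : ∀ x ∈ B, c x < d := by
    intro x hx
    obtain ⟨i, hi, hi'⟩ := hlt x hx
    rw [hc x]
    exact (Nat.sInf_le hi').trans_lt hi
  have hcne : ∀ x ∈ B, ∀ y ∈ B, G.Adj x y → key y < key x → c x ≠ c y := by
    intro x hx y hy hxy hlt' heq
    obtain ⟨i, -, hi'⟩ := hlt x hx
    have hmem := Nat.sInf_mem (s := {i | ¬ ∃ y, (key y < key x ∧ c y = i) ∧ y ∈ B ∧ G.Adj x y})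
      ⟨i, hi'⟩
    rw [← hc x] at hmem
    exact hmem ⟨y, ⟨hlt', heq.symm⟩, hy, hxy⟩
  refine ⟨fun x => ⟨min (c x) (d - 1), by omega⟩, ?_, fun x hx y hy hxy heq => ?_⟩
  · exact (measurable_from_top (f := fun n : ℕ => (⟨min n (d - 1), by omega⟩ : Fin d))).comp hmeas
  · have h1 := hcd x hx
    have h2 := hcd y hy
    have h3 : c x = c y := by
      have := congrArg Fin.val heq
      dsimp only at this
      omega
    rcases lt_or_gt_of_ne (hne x hx y hy hxy) with h | h
    · exact hcne y hy x hx hxy.symm h h3.symm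
    · exact hcne x hx y hy hxy h h3

/-- If every point of `U` is joined inside `U` to `A`, then there is a measurable key on `U \ A`
such that every point has a neighbor in `A` or of higher key. -/
lemma Sys.exists_layer_key (hs : Sys G g φ) {A U : Set X} (hA : MeasurableSet A)
    (hU : MeasurableSet U) (hAU : A ⊆ U) (hjoin : ∀ x ∈ U, ∃ y ∈ A, Joined G U x y) :
    ∃ a b : X → ℕ, Measurable a ∧ Measurable b ∧ ∀ v ∈ U, v ∉ A → ∃ w ∈ U, G.Adj v w ∧
      (w ∉ A → toLex (a v, b v) < toLex (a w, b w)) := by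
  classical
  let R : ℕ → X → Prop := fun n => Nat.rec (fun v => v ∈ A)
    (fun _ r v => v ∈ U ∧ ∃ w, G.Adj v w ∧ r w) n
  have hRm : ∀ n, Measurable (R n) := by
    intro n
    induction n with
    | zero => exact hA.mem
    | succ n ih =>
      refine hU.mem.and (hs.ex (f := id) ?_ measurable_id fun a z hz => hz.1.reachable)
      exact (hs.adj (by fun_prop) (by fun_prop)).and (ih.comp measurable_snd)
  have hRU : ∀ n v, R n v → v ∈ U := by
    intro n v h
    cases n with
    | zero => exact hAU h
    | succ n => exact h.1
  have hRex : ∀ v ∈ U, ∃ n, R n v := by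
    intro v hv
    obtain ⟨y, hy, hvy⟩ := hjoin v hv
    clear hv
    induction hvy using Relation.ReflTransGen.head_induction_on with
    | refl => exact ⟨0, hy⟩
    | @head u u' h _ ih =>
      obtain ⟨n, hn⟩ := ih
      exact ⟨n + 1, h.2.1, u', h.1, hn⟩
  set D : X → ℕ := fun v => sInf {n | R n v} with hD
  have hDm : Measurable D := measurable_sInf_nat hRm
  have hDR : ∀ v ∈ U, R (D v) v := fun v hv => Nat.sInf_mem (s := {n | R n v}) (hRex v hv)
  have hDle : ∀ n v, R n v → D v ≤ n := fun n v h => Nat.sInf_le h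
  have hparent : ∀ v ∈ U, v ∉ A → ∃ p ∈ U, G.Adj v p ∧ D v = D p + 1 := by
    intro v hv hvA
    have h := hDR v hv
    obtain ⟨m, hm⟩ : ∃ m, D v = m + 1 := by
      cases hm : D v with
      | zero => rw [hm] at h; exact absurd h hvA
      | succ m => exact ⟨m, rfl⟩
    rw [hm] at h
    obtain ⟨-, p, hvp, hp⟩ := h
    have hpU := hRU m p hp
    refine ⟨p, hpU, hvp, ?_⟩
    have h1 := hDle m p hp
    have h2 := hDle (D p + 1) v ⟨hv, p, hvp, hDR p hpU⟩
    omega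
  let C : ℕ → X → Prop := fun n => Nat.rec (fun _ => True)
    (fun _ r v => ∃ w, (G.Adj v w ∧ w ∈ U ∧ D w = D v + 1) ∧ r w) n
  have hCm : ∀ n, Measurable (C n) := by
    intro n
    induction n with
    | zero => exact measurable_const
    | succ n ih =>
      refine hs.ex (f := id) (P := fun v w => (G.Adj v w ∧ w ∈ U ∧ D w = D v + 1) ∧ C n w) ?_
        measurable_id fun a z hz => hz.1.1.reachable
      refine Measurable.and ((hs.adj (by fun_prop) (by fun_prop)).and
        ((hU.mem.comp measurable_snd).and ?_)) (ih.comp measurable_snd)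
      exact measurableSet_setOfPred.1 (measurableSet_eq_fun (hDm.comp measurable_snd)
        ((measurable_from_top (f := fun n : ℕ => n + 1)).comp (hDm.comp measurable_fst)))
  have hCsucc : ∀ n v, C (n + 1) v → C n v := by
    intro n
    induction n with
    | zero => exact fun v _ => trivial
    | succ n ih =>
      rintro v ⟨w, hw, hC⟩
      exact ⟨w, hw, ih w hC⟩
  have hCanti : ∀ m n v, n ≤ m → C m v → C n v := by
    intro m n v hnm h
    induction m, hnm using Nat.le_induction with
    | base => exact h
    | succ m _ ih => exact ih (hCsucc m v h)
  have hchild : ∀ v, (∀ n, C n v) → ∃ w, G.Adj v w ∧ w ∈ U ∧ D w = D v + 1 ∧ ∀ n, C n w := by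
    intro v hv
    by_contra! hcon
    choose! m hm using hcon
    obtain ⟨M, hM⟩ := ((hs.fin v).image m).bddAbove
    obtain ⟨w, ⟨h1, h2, h3⟩, h4⟩ := hv (M + 1)
    exact hm w h1 h2 h3 (hCanti _ _ _ (hM ⟨w, h1, rfl⟩) h4)
  have hC0 : ∀ v, C 0 v := fun v => trivial
  have hCs : ∀ n v w, G.Adj v w → w ∈ U → D w = D v + 1 → C n w → C (n + 1) v :=
    fun n v w h1 h2 h3 h4 => ⟨w, ⟨h1, h2, h3⟩, h4⟩
  clear_value C
  set H : X → ℕ := fun v => sInf {n | ¬ C n v} with hH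
  have hHm : Measurable H := measurable_sInf_nat fun n => (hCm n).not
  have hinf : MeasurableSet {v | ∀ n, C n v} :=
    measurableSet_setOfPred.2 (Measurable.forall hCm)
  set a : X → ℕ := fun v => if ∀ n, C n v then 1 else 0 with ha
  set b : X → ℕ := fun v => if ∀ n, C n v then D v else H v with hb
  have ham : Measurable a := Measurable.ite hinf measurable_const measurable_const
  have hbm : Measurable b := Measurable.ite hinf hDm hHm
  refine ⟨a, b, ham, hbm, fun v hv hvA => ?_⟩
  rw [ha, hb]
  by_cases hvi : ∀ n, C n v
  · obtain ⟨w, h1, h2, h3, h4⟩ := hchild v hvi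
    refine ⟨w, h2, h1, fun _ => ?_⟩
    simp only [hvi, h4, implies_true, if_true, Prod.Lex.toLex_lt_toLex, h3]
    exact Or.inr ⟨trivial, Nat.lt_succ_self _⟩
  · obtain ⟨p, hp, hvp, hDp⟩ := hparent v hv hvA
    refine ⟨p, hp, hvp, fun _ => ?_⟩
    by_cases hpi : ∀ n, C n p
    · simp only [hvi, hpi, implies_true, if_true, if_false, Prod.Lex.toLex_lt_toLex]
      omega
    · simp only [hvi, hpi, if_false, Prod.Lex.toLex_lt_toLex]
      refine Or.inr ⟨trivial, ?_⟩
      push Not at hpi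
      have hmem : ¬ C (H p) p := Nat.sInf_mem (s := {n | ¬ C n p}) hpi
      obtain ⟨m, hm⟩ : ∃ m, H p = m + 1 := by
        cases hm : H p with
        | zero => rw [hm] at hmem; exact absurd (hC0 p) hmem
        | succ m => exact ⟨m, rfl⟩
      rw [hm] at hmem ⊢
      have : ¬ C m v := fun hC => hmem (hCs m p v hvp.symm hv hDp hC)
      exact Nat.lt_succ_of_le (Nat.sInf_le this)

/-- Coloring of the points lost along a decreasing sequence of sets. -/
lemma Sys.peel (hs : Sys G g φ) (hd : 0 < d) (hdeg : ∀ x, (G.neighborSet x).ncard ≤ d)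
    {U : ℕ → Set X} (hU : ∀ n, MeasurableSet (U n)) (hU0 : U 0 = Set.univ)
    (hdecr : ∀ n, U (n + 1) ⊆ U n)
    (hjoin : ∀ n, ∀ x ∈ U n, ∃ y ∈ U (n + 1), Joined G (U n) x y) :
    ∃ c : X → Fin d, Measurable c ∧ ∀ x y, x ∉ ⋂ n, U n → y ∉ ⋂ n, U n → G.Adj x y →
      c x ≠ c y := by
  classical
  choose a b ha hb hab using fun n => hs.exists_layer_key (hU (n + 1)) (hU n) (hdecr n) (hjoin n)
  obtain ⟨V, hVm, hVd, hVu⟩ := hs.exists_discrete_cover 1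
  set c1 : X → ℕ := fun x => sInf {n | x ∈ V n} with hc1
  have hc1m : Measurable c1 := measurable_sInf_nat fun n => (hVm n).mem
  have hc1V : ∀ x, x ∈ V (c1 x) := fun x => Nat.sInf_mem (s := {n | x ∈ V n})
    (Set.mem_iUnion.1 (hVu ▸ Set.mem_univ x))
  have hc1ne : ∀ x y, G.Adj x y → c1 x ≠ c1 y := fun x y hxy heq =>
    hxy.ne (hVd _ x (hc1V x) y (heq ▸ hc1V y) (near_one hxy))
  set st : X → ℕ := fun x => sInf {n | x ∉ U (n + 1)} with hst
  have hstm : Measurable st := measurable_sInf_nat fun n => (hU (n + 1)).mem.not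
  have hanti : Antitone U := antitone_nat_of_succ_le hdecr
  have hst1 : ∀ x, x ∉ ⋂ n, U n → x ∈ U (st x) ∧ x ∉ U (st x + 1) := by
    intro x hx
    obtain ⟨n, hn⟩ : ∃ n, x ∉ U (n + 1) := by
      by_contra! hcon
      exact hx (Set.mem_iInter.2 fun n => hdecr n (hcon n))
    refine ⟨?_, Nat.sInf_mem (s := {n | x ∉ U (n + 1)}) ⟨n, hn⟩⟩
    cases hk : st x with
    | zero => rw [hU0]; trivial
    | succ k =>
      by_contra hc
      have : st x ≤ k := Nat.sInf_le hc
      omega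
  have hst2 : ∀ x n, x ∉ ⋂ n, U n → x ∈ U n → n ≤ st x := by
    intro x n hx hxn
    by_contra! hlt
    exact (hst1 x hx).2 (hanti hlt hxn)
  let key : X → ℕ ×ₗ (ℕ ×ₗ ℕ) ×ₗ ℕ := fun x =>
    toLex (st x, toLex (toLex (a (st x) x, b (st x) x), c1 x))
  have hcount : Countable (ℕ ×ₗ (ℕ ×ₗ ℕ) ×ₗ ℕ) :=
    inferInstanceAs (Countable (ℕ × (ℕ × ℕ) × ℕ))
  have hnat : ∀ {f : X → ℕ} (n : ℕ), Measurable f → Measurable fun x => f x = n :=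
    fun n hf => measurableSet_setOfPred.1 (hf (measurableSet_singleton n))
  have hkeym : ∀ k, Measurable fun x => key x = k := by
    intro k
    have : (fun x => key x = k) = fun x => st x = (ofLex k).1 ∧
        (a (ofLex k).1 x = (ofLex (ofLex (ofLex k).2).1).1 ∧
          b (ofLex k).1 x = (ofLex (ofLex (ofLex k).2).1).2) ∧ c1 x = (ofLex (ofLex k).2).2 := by
      ext x
      constructor
      · rintro rfl
        exact ⟨rfl, ⟨rfl, rfl⟩, rfl⟩
      · rintro ⟨h1, ⟨h2, h3⟩, h4⟩
        change toLex (st x, toLex (toLex (a (st x) x, b (st x) x), c1 x)) = k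
        rw [h1, h2, h3, h4]
        rfl
    rw [this]
    exact (hnat _ hstm).and (((hnat _ (ha _)).and (hnat _ (hb _))).and (hnat _ hc1m))
  have hB : MeasurableSet (⋂ n, U n)ᶜ := (MeasurableSet.iInter hU).compl
  obtain ⟨c, hc, hc'⟩ := hs.greedy hd hdeg hkeym hB
    (fun x _ y _ hxy heq => hc1ne x y hxy (by
      have := congrArg (fun k => (ofLex (ofLex k).2).2) heq
      exact this))
    (fun x hx => by
      obtain ⟨h1, h2⟩ := hst1 x hx
      obtain ⟨w, hwU, hxw, hw⟩ := hab (st x) x h1 h2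
      refine ⟨w, hxw, fun hwB => ?_⟩
      by_cases hwn : w ∈ U (st x + 1)
      · have := hst2 w _ hwB hwn
        exact Prod.Lex.toLex_lt_toLex.2 (Or.inl (by dsimp only; omega))
      · have h3 := hst2 w _ hwB hwU
        have h4 : st w = st x := by
          by_contra hne
          exact (hst1 w hwB).1 |> fun h => hwn (hanti (by omega) h)
        refine Prod.Lex.toLex_lt_toLex.2 (Or.inr ⟨h4.symm, ?_⟩)
        refine Prod.Lex.toLex_lt_toLex.2 (Or.inl ?_)
        dsimp only
        rw [h4]
        exact hw hwn)
  exact ⟨c, hc, fun x y hx hy => hc' x hx y hy⟩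

end Greedy

section TrimMeasurable

variable {X : Type*} [MeasurableSpace X] {G T : SimpleGraph X} {g : ℕ → X → X} {φ : X → ℝ}
  {Y A U : Set X}

lemma Sys.measurable_tree (hs : Sys G g φ) (hY : MeasurableSet Y) :
    Measurable fun q : X × X => (tree G Y φ).Adj q.1 q.2 := by
  have hlt : Measurable fun t : (X × X) × X × X =>
      G.Adj t.2.1 t.2.2 ∧ lab φ t.2.1 t.2.2 < lab φ t.1.1 t.1.2 := by
    refine (hs.adj (by fun_prop) (by fun_prop)).and ?_
    have hφ := hs.meas_φ
    simp only [lab, Prod.Lex.toLex_lt_toLex]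
    refine Measurable.or ?_ (Measurable.and ?_ ?_)
    · exact measurableSet_setOfPred.1 (measurableSet_lt (by fun_prop) (by fun_prop))
    · exact measurableSet_setOfPred.1 (measurableSet_eq_fun (by fun_prop) (by fun_prop))
    · exact measurableSet_setOfPred.1 (measurableSet_lt (by fun_prop) (by fun_prop))
  have hr := hs.rtg (R := fun (q : X × X) a b => G.Adj a b ∧ lab φ a b < lab φ q.1 q.2) hlt
    fun _ _ _ h => h.1.reachable
  exact (hs.adj (by fun_prop) (by fun_prop)).and ((hY.mem.comp measurable_fst).and
    ((hY.mem.comp measurable_snd).and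
      (hr.comp (by fun_prop : Measurable fun q : X × X => (q, q.1, q.2))).not))

variable (hs : Sys G g φ) (hTG : T ≤ G) (hT : Measurable fun q : X × X => T.Adj q.1 q.2)

include hs hTG hT

lemma Sys.measurable_deg3 (hU : MeasurableSet U) : Measurable (Deg3 T U) := by
  unfold Deg3
  have hTm : ∀ {α : Type _} [MeasurableSpace α] {f h : α → X}, Measurable f → Measurable h →
      Measurable fun a => T.Adj (f a) (h a) := fun hf hh => hT.comp (hf.prodMk hh)
  refine hs.ex (f := id) ?_ measurable_id fun v a h => by
    obtain ⟨_, _, _, _, _, h, _⟩ := h; exact (hTG h.1).reachable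
  refine hs.ex (f := fun q : X × X => q.1) (P := fun q b => ∃ c, q.2 ≠ b ∧ q.2 ≠ c ∧ b ≠ c ∧
    (T.Adj q.1 q.2 ∧ q.2 ∈ U) ∧ (T.Adj q.1 b ∧ b ∈ U) ∧ T.Adj q.1 c ∧ c ∈ U) ?_ measurable_fst
    fun v a h => by
      obtain ⟨_, _, _, _, _, h, _⟩ := h; exact (hTG h.1).reachable
  refine hs.ex (f := fun q : (X × X) × X => q.1.1)
    (P := fun q c => q.1.2 ≠ q.2 ∧ q.1.2 ≠ c ∧ q.2 ≠ c ∧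
    (T.Adj q.1.1 q.1.2 ∧ q.1.2 ∈ U) ∧ (T.Adj q.1.1 q.2 ∧ q.2 ∈ U) ∧ T.Adj q.1.1 c ∧ c ∈ U) ?_
    (by fun_prop) fun v a h => by
      obtain ⟨_, _, _, _, _, h, _⟩ := h; exact (hTG h).reachable
  refine (hs.eq ?_ ?_).not.and ((hs.eq ?_ ?_).not.and ((hs.eq ?_ ?_).not.and
    (((hTm ?_ ?_).and (hU.mem.comp ?_)).and (((hTm ?_ ?_).and (hU.mem.comp ?_)).and
      ((hTm ?_ ?_).and (hU.mem.comp ?_)))))) <;> fun_prop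

lemma Sys.measurable_trim (hA : MeasurableSet A) (hU : MeasurableSet U) :
    MeasurableSet (Trim T A U) := by
  have h3 := hs.measurable_deg3 hTG hT hU
  refine measurableSet_setOfPred.2 (hU.mem.and (hs.ex (f := id) ?_ measurable_id
    fun z x h => ?_).not)
  · refine ((hA.mem.comp measurable_snd).and (hU.mem.comp measurable_snd)).and ?_
    refine hs.rtg' (R := fun a b => T.Adj a b ∧ b ∈ U ∧ ¬ Deg3 T U b) ?_
      (fun x y h => (hTG h.1).reachable) measurable_snd measurable_fst
    exact hT.and ((hU.mem.comp measurable_snd).and (h3.comp measurable_snd).not)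
  · have : G.Reachable x z := by
      induction h.2 with
      | refl => exact SimpleGraph.Reachable.refl _
      | tail _ h' ih => exact (ih ⟨h.1, by assumption⟩).trans (hTG h'.1).reachable
    exact this.symm

end TrimMeasurable

/-- Every coloring by `d` colors of the outer boundary of the tuple `e` extends to the tuple. -/
def Good {X : Type*} (G : SimpleGraph X) (d : ℕ) {k : ℕ} (e : Fin k → X) : Prop :=
  0 < k ∧ ∀ L : Fin k → Finset (Fin d),
    (∀ i, ((d - (L i).card : ℕ) : ℕ∞) ≤ {z | G.Adj (e i) z ∧ ∀ i', ¬ e i' = z}.encard) →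
    ∃ col : Fin k → Fin d, (∀ i, col i ∈ L i) ∧ ∀ i i', G.Adj (e i) (e i') → col i ≠ col i'

section Good

variable {X : Type*} {G : SimpleGraph X} {d k : ℕ} {S : Set X} {x : X} {e : Fin k → X}

lemma Good.exists_extension (he : Good G d e) (c : X → Fin d) :
    ∃ col : Fin k → Fin d, (∀ i z, G.Adj (e i) z → (∀ i', ¬ e i' = z) → col i ≠ c z) ∧
      ∀ i i', G.Adj (e i) (e i') → col i ≠ col i' := by
  classical
  obtain ⟨col, h1, h2⟩ := he.2 (fun i => Finset.univ.filter fun q => ¬ ∃ z,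
    (G.Adj (e i) z ∧ ∀ i', ¬ e i' = z) ∧ c z = q) fun i => by
      have h1 := Finset.card_filter_add_card_filter_not (s := (Finset.univ : Finset (Fin d)))
        (fun q => ∃ z, (G.Adj (e i) z ∧ ∀ i', ¬ e i' = z) ∧ c z = q)
      rw [Finset.card_univ, Fintype.card_fin] at h1
      refine le_trans ?_ (Set.encard_image_le c _)
      have h2 : c '' {z | G.Adj (e i) z ∧ ∀ i', ¬ e i' = z} =
          ((Finset.univ.filter fun q => ∃ z, (G.Adj (e i) z ∧ ∀ i', ¬ e i' = z) ∧ c z = q :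
            Finset (Fin d)) : Set (Fin d)) := by
        ext q; simp
      rw [h2, Set.encard_coe_eq_coe_finsetCard]
      exact_mod_cast (by omega)
  refine ⟨col, fun i z hz hz' heq => ?_, h2⟩
  exact (Finset.mem_filter.1 (h1 i)).2 ⟨z, ⟨hz, hz'⟩, heq.symm⟩

lemma good_single (hfin : (G.neighborSet x).Finite) (hx : (G.neighborSet x).ncard < d) :
    Good G d fun _ : Fin 1 => x := by
  refine ⟨one_pos, fun L hL => ?_⟩
  have h0 := (hL 0).trans (Set.encard_le_encard (t := G.neighborSet x) fun z hz => hz.1)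
  rw [← hfin.cast_ncard_eq] at h0
  have h1 : d - (L 0).card ≤ (G.neighborSet x).ncard := by exact_mod_cast h0
  obtain ⟨q, hq⟩ : (L 0).Nonempty := Finset.card_pos.1 (by omega)
  refine ⟨fun _ => q, fun i => ?_, fun i i' h => absurd rfl h.ne⟩
  rw [Subsingleton.elim i 0]
  exact hq

lemma exists_good_of_not_regular (hfin : ∀ x, (G.neighborSet x).Finite)
    (hdeg : ∀ x, (G.neighborSet x).ncard ≤ d) (hS : S.Finite) (hb : Bicon G S)
    (hreg : ¬ ∃ k, ∀ v ∈ S, dg G S v = k) :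
    ∃ (k : ℕ) (e : Fin k → X), Good G d e ∧ Set.range e = S := by
  classical
  have hne : S.Nonempty := by
    by_contra hne
    exact hreg ⟨0, fun v hv => absurd ⟨v, hv⟩ hne⟩
  obtain ⟨k, ⟨E⟩⟩ : ∃ k, Nonempty (Fin k ≃ S) := by
    have := hS.to_subtype
    obtain ⟨k, ⟨E⟩⟩ := Finite.exists_equiv_fin S
    exact ⟨k, ⟨E.symm⟩⟩
  have hrange : Set.range (fun i => (E i : X)) = S := by
    ext x
    constructor
    · rintro ⟨i, rfl⟩; exact (E i).2
    · intro hx; exact ⟨E.symm ⟨x, hx⟩, by simp⟩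
  refine ⟨k, fun i => (E i : X), ⟨?_, fun L hL => ?_⟩, hrange⟩
  · obtain ⟨x, hx⟩ := hne
    exact (Nat.zero_le _).trans_lt (E.symm ⟨x, hx⟩).2
  · let L' : X → Finset (Fin d) := fun z => if h : z ∈ S then L (E.symm ⟨z, h⟩) else ∅
    have hL' : ∀ i, L' (E i) = L i := fun i => by
      simp only [L', (E i).2, dif_pos, Subtype.coe_eta, Equiv.symm_apply_apply]
    obtain ⟨col, h1, h2⟩ := ListCol.of_not_regular (L := L') hS hb hreg fun z hz => by
      obtain ⟨i, rfl⟩ : ∃ i, (E i : X) = z := by rw [← hrange] at hz; exact hz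
      rw [hL']
      have h0 := hL i
      have h3 : {z | G.Adj (E i) z ∧ ∀ i', ¬ (E i' : X) = z} = G.neighborSet (E i) \ S := by
        ext w
        have hw : w ∈ S ↔ ∃ i', (E i' : X) = w := by
          conv_lhs => rw [← hrange]
          exact Set.mem_range
        simp [hw]
      rw [h3, ← ((hfin _).sdiff).cast_ncard_eq] at h0
      have h4 : d - (L i).card ≤ (G.neighborSet (E i) \ S).ncard := by exact_mod_cast h0
      have h5 := Set.ncard_inter_add_ncard_sdiff_eq_ncard (G.neighborSet (E i : X)) S (hfin _)
      have h6 := hdeg (E i)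
      unfold dg
      omega
    exact ⟨fun i => col (E i), fun i => hL' i ▸ h1 _ (E i).2,
      fun i i' h => h2 _ (E i).2 _ (E i').2 h⟩

variable [MeasurableSpace X] {g : ℕ → X → X} {φ : X → ℝ} {α : Type*} [MeasurableSpace α]

lemma Sys.measurable_reachable (hs : Sys G g φ) : Measurable fun q : X × X =>
    G.Reachable q.1 q.2 := by
  have : (fun q : X × X => G.Reachable q.1 q.2) = fun q => ∃ n, g n q.1 = q.2 := by
    ext q
    exact ⟨hs.reach _ _, fun ⟨n, hn⟩ => hn ▸ hs.reachable n q.1⟩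
  rw [this]
  exact Measurable.exists fun n => hs.eq ((hs.meas_g n).comp measurable_fst) measurable_snd

lemma Sys.measurable_good (hs : Sys G g φ) (σ : Fin k → ℕ) :
    Measurable fun x => Good G d fun i => g (σ i) x := by
  refine measurable_const.and (Measurable.forall fun L => Measurable.imp
    (Measurable.forall fun i => ?_) (Measurable.exists fun col => measurable_const.and
      (Measurable.forall fun i => Measurable.forall fun i' =>
        Measurable.imp (hs.adj (hs.meas_g _) (hs.meas_g _)) measurable_const)))
  refine hs.le_encard ?_ (hs.meas_g (σ i)) (fun a z hz => hz.1.reachable) _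
  exact (hs.adj ((hs.meas_g _).comp measurable_fst) measurable_snd).and
    (Measurable.forall fun i' => (hs.eq ((hs.meas_g _).comp measurable_fst) measurable_snd).not)

/-- There is a measurable set `A` to which every coloring extends, and which meets every component
that is not tame. -/
lemma Sys.exists_reducible (hs : Sys G g φ) (hd : 3 ≤ d)
    (hdeg : ∀ x, (G.neighborSet x).ncard ≤ d) (hfree : G.CliqueFree (d + 1)) :
    ∃ A Y : Set X, MeasurableSet A ∧ MeasurableSet Y ∧ Tame G d Y ∧
      (∀ x ∉ Y, ∃ y ∈ A, G.Reachable x y) ∧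
      ∀ c₀ : X → Fin d, Measurable c₀ → ∃ c : X → Fin d, Measurable c ∧ (∀ x ∉ A, c x = c₀ x) ∧
        ∀ x ∈ A, ∀ y, G.Adj x y → c x ≠ c y := by
  classical
  choose l hl using hs.len
  choose V hVm hVd hVu using fun r => hs.exists_discrete_cover r
  obtain ⟨s, hsurj⟩ := exists_surjective_nat (Σ k, (Fin k → ℕ) × ℕ)
  let k : ℕ → ℕ := fun n => (s n).1
  let σ : ∀ n, Fin (k n) → ℕ := fun n => (s n).2.1
  let r : ℕ → ℕ := fun n => ∑ i, l (σ n i)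
  let W : ℕ → Set X := fun n => {x | Good G d (fun i => g (σ n i) x) ∧
    x ∈ V (2 * r n + 1) (s n).2.2}
  have hWm : ∀ n, MeasurableSet (W n) := fun n => measurableSet_setOfPred.2
    ((hs.measurable_good (σ n)).and (hVm _ _).mem)
  have hnear : ∀ n x i, Near G (r n) x (g (σ n i) x) := fun n x i =>
    (hl (σ n i) x).mono (Finset.single_le_sum (f := fun i => l (σ n i)) (fun _ _ => Nat.zero_le _)
      (Finset.mem_univ i))
  have hW : ∀ n, ∀ x ∈ W n, ∀ x' ∈ W n, ∀ i i', Near G 1 (g (σ n i) x) (g (σ n i') x') →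
      x = x' := fun n x hx x' hx' i i' h => by
    refine hVd _ _ x hx.2 x' hx'.2 ?_
    exact (((hnear n x i).trans h).trans (hnear n x' i').symm).mono (by omega)
  let M : ℕ → X → Prop := fun n x => ∃ y, G.Reachable x y ∧ y ∈ W n
  have hMm : ∀ n, Measurable (M n) := fun n => hs.ex (f := id)
    (hs.measurable_reachable.and ((hWm n).mem.comp measurable_snd)) measurable_id
    fun a z hz => hz.1
  have hMinv : ∀ n x y, G.Reachable x y → M n x → M n y := fun n x y hxy ⟨z, h1, h2⟩ =>
    ⟨z, hxy.symm.trans h1, h2⟩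
  let N : X → ℕ := fun x => sInf {n | M n x}
  have hNm : Measurable N := measurable_sInf_nat hMm
  have hNinv : ∀ x y, G.Reachable x y → N x = N y := fun x y hxy => by
    have : {n | M n x} = {n | M n y} := by
      ext n
      exact ⟨hMinv n x y hxy, hMinv n y x hxy.symm⟩
    change sInf _ = sInf _
    rw [this]
  let R : ℕ → X → Prop := fun n x => N x = n ∧ x ∈ W n
  have hRm : ∀ n, Measurable (R n) := fun n =>
    (measurableSet_setOfPred.1 (hNm (measurableSet_singleton n))).and (hWm n).mem
  let A : Set X := {z | ∃ n x, R n x ∧ ∃ i, g (σ n i) x = z}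
  have hreach : ∀ n x z, (R n x ∧ ∃ i, g (σ n i) x = z) → G.Reachable z x := by
    rintro n x z ⟨-, i, rfl⟩
    exact (hs.reachable _ _).symm
  have hAm : MeasurableSet A := by
    refine measurableSet_setOfPred.2 (Measurable.exists fun n => hs.ex (f := id) ?_ measurable_id
      fun z x h => hreach n x z h)
    exact ((hRm n).comp measurable_snd).and (Measurable.exists fun i =>
      hs.eq ((hs.meas_g _).comp measurable_snd) measurable_fst)
  let Y : Set X := {x | ¬ ∃ n, M n x}
  have hYm : MeasurableSet Y := measurableSet_setOfPred.2 (Measurable.exists hMm).not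
  have hYgood : ∀ (k' : ℕ) (e : Fin k' → X), Good G d e → (∀ i i', G.Reachable (e i) (e i')) →
      ∀ i, e i ∉ Y := by
    intro k' e he hre i hi
    choose τ hτ using fun i' => hs.reach _ _ (hre i i')
    obtain ⟨m, hm⟩ := Set.mem_iUnion.1 (hVu (2 * (∑ i', l (τ i')) + 1) ▸ Set.mem_univ (e i))
    obtain ⟨n, hn⟩ := hsurj ⟨k', τ, m⟩
    refine hi ⟨n, e i, SimpleGraph.Reachable.refl _, ?_⟩
    have hWn : W n = {x | Good G d (fun i => g ((s n).2.1 i) x) ∧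
      x ∈ V (2 * (∑ i, l ((s n).2.1 i)) + 1) (s n).2.2} := rfl
    rw [hWn, hn]
    refine ⟨?_, hm⟩
    simp only [hτ]
    exact he
  have hY : Tame G d Y := by
    refine ⟨hd, hs.fin, fun x y hxy hx ⟨n, hn⟩ => hx ⟨n, hMinv n y x hxy.symm.reachable hn⟩,
      fun x hx => ?_, hfree, fun S hSY hS hb => ?_⟩
    · by_contra hne
      exact hYgood 1 _ (good_single (hs.fin x) (lt_of_le_of_ne (hdeg x) hne))
        (fun _ _ => SimpleGraph.Reachable.refl _) 0 hx
    · by_contra hreg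
      obtain ⟨k', e, he, hrange⟩ := exists_good_of_not_regular hs.fin hdeg hS hb hreg
      have hmem : ∀ i, e i ∈ S := fun i => hrange ▸ ⟨i, rfl⟩
      exact hYgood k' e he (fun i i' => (hb.1 _ (hmem i) _ (hmem i')).reachable) ⟨0, he.1⟩
        (hSY (hmem _))
  refine ⟨A, Y, hAm, hYm, hY, fun x hx => ?_, fun c₀ hc₀ => ?_⟩
  · have hM : M (N x) x := Nat.sInf_mem (s := {n | M n x}) (not_not.1 hx)
    obtain ⟨y, hxy, hy⟩ := hM
    exact ⟨_, ⟨N x, y, ⟨(hNinv x y hxy).symm, hy⟩, ⟨0, hy.1.1⟩, rfl⟩,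
      hxy.trans (hs.reachable _ _)⟩
  have hcolor : ∀ n, ∃ F : X → (Fin (k n) → Fin d), (∀ col, Measurable fun x => F x = col) ∧
      ∀ x ∈ W n, (∀ i z, G.Adj (g (σ n i) x) z → (∀ i', ¬ g (σ n i') x = z) → F x i ≠ c₀ z) ∧
        ∀ i i', G.Adj (g (σ n i) x) (g (σ n i') x) → F x i ≠ F x i' := by
    intro n
    have : Nonempty (Fin d) := ⟨⟨0, by omega⟩⟩
    obtain ⟨F, hF, hF'⟩ := exists_measurable_choice (P := fun (col : Fin (k n) → Fin d) x =>
      (∀ i, ¬ ∃ z, G.Adj (g (σ n i) x) z ∧ (∀ i', ¬ g (σ n i') x = z) ∧ col i = c₀ z) ∧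
        ∀ i i', G.Adj (g (σ n i) x) (g (σ n i') x) → col i ≠ col i') fun col => by
      refine Measurable.and (Measurable.forall fun i => Measurable.not ?_)
        (Measurable.forall fun i => Measurable.forall fun i' =>
          Measurable.imp (hs.adj (hs.meas_g _) (hs.meas_g _)) measurable_const)
      refine hs.ex ?_ (hs.meas_g (σ n i)) fun a z hz => hz.1.reachable
      refine (hs.adj ((hs.meas_g _).comp measurable_fst) measurable_snd).and
        ((Measurable.forall fun i' =>
          (hs.eq ((hs.meas_g _).comp measurable_fst) measurable_snd).not).and ?_)
      exact measurableSet_setOfPred.1 (measurableSet_eq_fun measurable_const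
        (hc₀.comp measurable_snd))
    refine ⟨F, hF, fun x hx => ?_⟩
    obtain ⟨col, h1, h2⟩ := hx.1.exists_extension c₀
    obtain ⟨h3, h4⟩ := hF' x ⟨col, fun i ⟨z, hz, hz', h⟩ => h1 i z hz hz' h, h2⟩
    exact ⟨fun i z hz hz' h => h3 i ⟨z, hz, hz', h⟩, h4⟩
  choose F hFm hF using hcolor
  have : Nonempty (Fin d) := ⟨⟨0, by omega⟩⟩
  obtain ⟨c, hc, hc'⟩ := exists_measurable_choice (P := fun (q : Fin d) z =>
    (∃ n x, R n x ∧ ∃ i, g (σ n i) x = z ∧ F n x i = q) ∨ (z ∉ A ∧ c₀ z = q)) fun q => by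
      refine Measurable.or (Measurable.exists fun n => hs.ex (f := id) ?_ measurable_id
        fun z x ⟨h1, i, h2, _⟩ => hreach n x z ⟨h1, i, h2⟩) (hAm.mem.not.and
          (measurableSet_setOfPred.1 (hc₀ (measurableSet_singleton q))))
      refine ((hRm n).comp measurable_snd).and (Measurable.exists fun i =>
        (hs.eq ((hs.meas_g _).comp measurable_snd) measurable_fst).and ?_)
      have : (fun x => F n x i = q) = fun x => ∃ col, F n x = col ∧ col i = q := by
        ext x; simp
      have hm : Measurable fun x => F n x i = q := by
        rw [this]
        exact Measurable.exists fun col => (hFm n col).and measurable_const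
      exact hm.comp measurable_snd
  have hcA : ∀ z ∈ A, ∃ n x, R n x ∧ ∃ i, g (σ n i) x = z ∧ F n x i = c z := by
    intro z hz
    obtain ⟨n, x, h1, i, h2⟩ := hz
    rcases hc' z ⟨F n x i, Or.inl ⟨n, x, h1, i, h2, rfl⟩⟩ with h | h
    · exact h
    · exact absurd ⟨n, x, h1, i, h2⟩ h.1
  have hcA' : ∀ z ∉ A, c z = c₀ z := by
    intro z hz
    rcases hc' z ⟨c₀ z, Or.inr ⟨hz, rfl⟩⟩ with ⟨n, x, h1, i, h2, -⟩ | h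
    · exact absurd ⟨n, x, h1, i, h2⟩ hz
    · exact h.2.symm
  refine ⟨c, measurable_to_countable' fun q => measurableSet_setOfPred.2 (hc q), hcA',
    fun z hz y hzy => ?_⟩
  obtain ⟨n, x, hx, i, rfl, h⟩ := hcA z hz
  rw [← h]
  by_cases hy : y ∈ A
  · obtain ⟨n', x', hx', i', rfl, h'⟩ := hcA y hy
    rw [← h']
    obtain rfl : n = n' := by
      rw [← hx.1, ← hx'.1]
      exact hNinv _ _ (((hs.reachable _ _).trans hzy.reachable).trans (hs.reachable _ _).symm)
    obtain rfl := hW n x hx.2 x' hx'.2 i i' (near_one hzy)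
    exact (hF n x hx.2).2 i i' hzy
  · rw [hcA' y hy]
    refine (hF n x hx.2).1 i y hzy fun i' h' => hy ⟨n, x, hx, i', h'⟩

/-- The branching constants of the successive trimmings. -/
def scale : ℕ → ℕ
  | 0 => 2
  | n + 1 => 2 * scale n + 1

/-- A measurable form of Brooks's theorem, assuming a cover by sufficiently sparse sets. -/
theorem Sys.brooks (hs : Sys G g φ) (hd : 3 ≤ d) (hdeg : ∀ x, (G.neighborSet x).ncard ≤ d)
    (hfree : G.CliqueFree (d + 1)) {B : ℕ → Set X} (hB : ∀ n, MeasurableSet (B n))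
    (hBd : ∀ n, Discrete G (4 * scale n + 10) (B n)) (hBu : ⋃ n, B n = Set.univ) :
    ∃ c : X → Fin d, Measurable c ∧ ∀ x y, G.Adj x y → c x ≠ c y := by
  obtain ⟨A, Y, hA, hY, hYt, hAY, hext⟩ := hs.exists_reducible hd hdeg hfree
  let T := tree G Y φ
  have hTG : T ≤ G := fun _ _ h => h.1
  have hTm : Measurable fun q : X × X => T.Adj q.1 q.2 := hs.measurable_tree hY
  have hsep : ∀ z p q, T.Adj z p → T.Adj z q → p ≠ q → ¬ Joined T {z}ᶜ p q :=
    fun _ _ _ => tree_separates hs.inj_φ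
  let Z : ℕ → Set X := fun n => Nat.rec Y (fun n U => Trim T (B n) U) n
  have hZm : ∀ n, MeasurableSet (Z n) := fun n => by
    induction n with
    | zero => exact hY
    | succ n ih => exact hs.measurable_trim hTG hTm (hB n) ih
  have hZb : ∀ n, Bushy T (scale n) (Z n) := fun n => by
    induction n with
    | zero => exact hYt.bushy
    | succ n ih => exact ih.trim hTG hsep (hBd n)
  have hZd : ∀ n, Z (n + 1) ⊆ Z n := fun n x hx => hx.1
  have hZB : ∀ n x, x ∈ B n → x ∉ Z (n + 1) := fun n x hx hxZ =>
    hxZ.2 ⟨x, ⟨hx, hxZ.1⟩, Relation.ReflTransGen.refl⟩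
  let U : ℕ → Set X := fun n => Nat.casesOn n Set.univ fun n => A ∪ Z n
  have hUA : ⋂ n, U n ⊆ A := by
    intro x hx
    obtain ⟨n, hn⟩ := Set.mem_iUnion.1 (hBu ▸ Set.mem_univ x : x ∈ ⋃ n, B n)
    exact (Set.mem_iInter.1 hx (n + 2)).resolve_right (hZB n x hn)
  obtain ⟨c₀, hc₀, hc₀'⟩ := hs.peel (U := U) (by omega) hdeg
    (fun n => by
      cases n with
      | zero => exact MeasurableSet.univ
      | succ n => exact hA.union (hZm n))
    rfl
    (fun n => by
      cases n with
      | zero => exact Set.subset_univ _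
      | succ n => exact Set.union_subset_union_right _ (hZd n))
    (fun n x hx => by
      cases n with
      | zero =>
        by_cases hxY : x ∈ Y
        · exact ⟨x, Or.inr hxY, Joined.refl⟩
        · obtain ⟨y, hy, hxy⟩ := hAY x hxY
          refine ⟨y, Or.inl hy, ?_⟩
          obtain ⟨w⟩ := hxy
          clear hx hy hxY
          induction w with
          | nil => exact Joined.refl
          | cons h _ ih => exact (Joined.single h (Set.mem_univ _) (Set.mem_univ _)).trans ih
      | succ n =>
        rcases hx with hx | hx
        · exact ⟨x, Or.inl hx, Joined.refl⟩
        · obtain ⟨y, hy, hxy⟩ := (hZb n).exists_joined_trim hTG hsep (hBd n) hx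
          exact ⟨y, Or.inr hy, hxy.mono Set.subset_union_right⟩)
  obtain ⟨c, hc, h1, h2⟩ := hext c₀ hc₀
  refine ⟨c, hc, fun x y hxy => ?_⟩
  by_cases hx : x ∈ A
  · exact h2 x hx y hxy
  by_cases hy : y ∈ A
  · exact (h2 y hy x hxy.symm).symm
  rw [h1 x hx, h1 y hy]
  exact hc₀' x y (fun h => hx (hUA h)) (fun h => hy (hUA h)) hxy

end Good

section Borel

variable {X : Type*} [MeasurableSpace X] [StandardBorelSpace X]

/-- The Lusin–Novikov theorem for Borel sets with sections of bounded size. -/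
lemma exists_measurable_enumeration (n : ℕ) {R : Set (X × X)} (hR : MeasurableSet R)
    (hn : ∀ x, {y | (x, y) ∈ R}.encard ≤ n) :
    ∃ h : Fin n → X → X, (∀ i, Measurable (h i)) ∧ ∀ x y, (x, y) ∈ R → ∃ i, h i x = y := by
  classical
  induction n generalizing R with
  | zero =>
    refine ⟨fun i => i.elim0, fun i => i.elim0, fun x y hxy => ?_⟩
    have := hn x
    rw [Nat.cast_zero, nonpos_iff_eq_zero, Set.encard_eq_zero] at this
    exact absurd hxy (Set.eq_empty_iff_forall_notMem.1 this y)
  | succ n ih =>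
    let φ := embeddingReal X
    have hφ : MeasurableEmbedding φ := measurableEmbedding_embeddingReal X
    let K : Set (X × (Fin (n + 1) → X)) :=
      {p | (∀ i, (p.1, p.2 i) ∈ R) ∧ ∀ i j, i < j → φ (p.2 i) < φ (p.2 j)}
    have hKm : MeasurableSet K := by
      have hφm := hφ.measurable
      refine measurableSet_setOfPred.2 (Measurable.and (Measurable.forall fun i => ?_)
        (Measurable.forall fun i => Measurable.forall fun j =>
          Measurable.imp measurable_const ?_))
      · exact hR.mem.comp (by fun_prop : Measurable fun p : X × (Fin (n + 1) → X) => (p.1, p.2 i))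
      · exact measurableSet_setOfPred.1 (measurableSet_lt (by fun_prop) (by fun_prop))
    have hKr : ∀ p ∈ K, Set.range p.2 = {y | (p.1, y) ∈ R} := by
      rintro ⟨x, y⟩ ⟨h1, h2⟩
      have hinj : Function.Injective y := fun i j hij => by
        rcases lt_trichotomy i j with h | h | h
        · exact absurd (congrArg φ hij) (h2 i j h).ne
        · exact h
        · exact absurd (congrArg φ hij) (h2 j i h).ne'
      refine Set.Finite.eq_of_subset_of_encard_le
        (Set.finite_range y) ?_ ?_
      · rintro _ ⟨i, rfl⟩; exact h1 i
      · refine (hn x).trans ?_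
        rw [← Set.image_univ, hinj.encard_image, Set.encard_univ]
        simp
    have hKi : Set.InjOn Prod.fst K := by
      rintro ⟨x, y⟩ hy ⟨x', y'⟩ hy' (rfl : x = x')
      have hr : Set.range (φ ∘ y) = Set.range (φ ∘ y') := by
        rw [Set.range_comp, Set.range_comp, hKr _ hy, hKr _ hy']
      have h1 : StrictMono (φ ∘ y) := fun i j hij => hy.2 i j hij
      have h2 : StrictMono (φ ∘ y') := fun i j hij => hy'.2 i j hij
      have := (h1.range_inj h2).1 hr
      rw [Prod.mk.injEq]
      exact ⟨rfl, hφ.injective.comp_left this⟩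
    have himg : ∀ K' ⊆ K, MeasurableSet K' → MeasurableSet (Prod.fst '' K') := fun K' h h' =>
      h'.image_of_measurable_injOn measurable_fst (hKi.mono h)
    have hKs : ∀ x, ¬ x ∈ Prod.fst '' K → {y | (x, y) ∈ R}.encard ≤ n := by
      intro x hx
      by_contra! hlt
      have hcard : {y | (x, y) ∈ R}.encard = (n + 1 : ℕ) :=
        le_antisymm (hn x) (by exact_mod_cast Order.add_one_le_of_lt hlt)
      have hfin := Set.finite_of_encard_eq_coe hcard
      have hc : (hfin.toFinset.image φ).card = n + 1 := by
        rw [Finset.card_image_of_injective _ hφ.injective]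
        rw [hfin.encard_eq_coe_toFinset_card] at hcard
        exact_mod_cast hcard
      let o := (hfin.toFinset.image φ).orderEmbOfFin hc
      have ho : ∀ i, ∃ y, (x, y) ∈ R ∧ φ y = o i := fun i => by
        have := Finset.orderEmbOfFin_mem _ hc i
        rw [Finset.mem_image] at this
        obtain ⟨y, hy, hyo⟩ := this
        exact ⟨y, hfin.mem_toFinset.1 hy, hyo⟩
      choose y hy hyo using ho
      refine hx ⟨(x, y), ⟨hy, fun i j hij => ?_⟩, rfl⟩
      rw [hyo, hyo]
      exact o.strictMono hij
    have hψ : ∀ x, ∃ y : Fin (n + 1) → X, x ∈ Prod.fst '' K → (x, y) ∈ K := by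
      intro x
      by_cases hx : x ∈ Prod.fst '' K
      · obtain ⟨⟨x', y⟩, hy, rfl⟩ := hx
        exact ⟨y, fun _ => hy⟩
      · exact ⟨fun _ => x, fun h => absurd h hx⟩
    choose ψ hψ using hψ
    have hD : MeasurableSet (Prod.fst '' K) := himg K subset_rfl hKm
    obtain ⟨h', hm', hh'⟩ := ih (R := R ∩ Prod.fst ⁻¹' (Prod.fst '' K)ᶜ)
      (hR.inter (measurable_fst hD.compl)) fun x => by
        by_cases hx : x ∈ Prod.fst '' K
        · have : {y | (x, y) ∈ R ∩ Prod.fst ⁻¹' (Prod.fst '' K)ᶜ} = ∅ :=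
            Set.eq_empty_of_forall_notMem fun y hy => hy.2 hx
          rw [this, Set.encard_empty]
          exact zero_le
        · exact (Set.encard_le_encard fun y hy => hy.1).trans (hKs x hx)
    let h'' : Fin (n + 1) → X → X := fun i => if hi : i.1 < n then h' ⟨i, hi⟩ else id
    have hm'' : ∀ i, Measurable (h'' i) := fun i => by
      by_cases hi : i.1 < n
      · simp only [h'', hi, dif_pos]; exact hm' _
      · simp only [h'', hi, dif_neg, not_false_eq_true]; exact measurable_id
    refine ⟨fun i x => if x ∈ Prod.fst '' K then ψ x i else h'' i x, fun i s hs => ?_,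
      fun x y hxy => ?_⟩
    · have : (fun x => if x ∈ Prod.fst '' K then ψ x i else h'' i x) ⁻¹' s =
          Prod.fst '' (K ∩ {p | p.2 i ∈ s}) ∪ (h'' i ⁻¹' s ∩ (Prod.fst '' K)ᶜ) := by
        ext x
        by_cases hx : x ∈ Prod.fst '' K
        · simp only [Set.mem_preimage, hx, if_true, Set.mem_union, Set.mem_inter_iff,
            Set.mem_compl_iff, not_true, and_false, or_false]
          constructor
          · intro h
            exact ⟨(x, ψ x), ⟨hψ x hx, h⟩, rfl⟩
          · rintro ⟨p, ⟨hp, hps⟩, rfl⟩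
            have := hKi (hψ p.1 hx) hp rfl
            rw [← this] at hps
            exact hps
        · simp only [Set.mem_preimage, hx, if_false, Set.mem_union, Set.mem_inter_iff,
            Set.mem_compl_iff, not_false_eq_true, and_true]
          refine ⟨Or.inr, fun h => h.resolve_left ?_⟩
          rintro ⟨p, hp, rfl⟩
          exact hx ⟨p, hp.1, rfl⟩
      rw [this]
      refine (himg _ Set.inter_subset_left (hKm.inter ?_)).union ((hm'' i hs).inter hD.compl)
      exact ((measurable_pi_apply i).comp measurable_snd) hs
    · by_cases hx : x ∈ Prod.fst '' K
      · have : y ∈ Set.range (ψ x) := by rw [hKr _ (hψ x hx)]; exact hxy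
        obtain ⟨i, hi⟩ := this
        exact ⟨i, by simp only [hx, if_true, hi]⟩
      · obtain ⟨i, hi⟩ := hh' x y ⟨hxy, hx⟩
        refine ⟨i.castSucc, ?_⟩
        simp only [hx, if_false, h'', Fin.val_castSucc, i.2, dif_pos, Fin.eta, hi]

/-- A Borel graph of bounded degree is generated by countably many Borel functions. -/
lemma exists_sys {G : SimpleGraph X} (hG : MeasurableSet {p : X × X | G.Adj p.1 p.2}) {d : ℕ}
    (hdeg : ∀ x, (G.neighborSet x).encard ≤ d) : ∃ g φ, Sys G g φ := by
  classical
  obtain ⟨h, hm, hh⟩ := exists_measurable_enumeration d hG hdeg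
  let s : Fin d → X → X := fun i x => if G.Adj x (h i x) then h i x else x
  have hadj : ∀ f : X → X, Measurable f → MeasurableSet {x | G.Adj x (f x)} := fun f hf =>
    (measurable_id.prodMk hf) hG
  have hsm : ∀ i, Measurable (s i) := fun i =>
    Measurable.ite (hadj _ (hm i)) (hm i) measurable_id
  have hsn : ∀ i x, Near G 1 x (s i x) := fun i x => by
    by_cases hx : G.Adj x (h i x)
    · simp only [s, hx, if_true]; exact near_one hx
    · simp only [s, hx, if_false]; exact ⟨SimpleGraph.Walk.nil, by simp⟩
  let w : List (Fin d) → X → X := fun l x => l.foldr s x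
  have hwm : ∀ l, Measurable (w l) := fun l => by
    induction l with
    | nil => exact measurable_id
    | cons i l ih => exact (hsm i).comp ih
  have hwn : ∀ l x, Near G l.length x (w l x) := fun l x => by
    induction l with
    | nil => exact ⟨SimpleGraph.Walk.nil, le_rfl⟩
    | cons i l ih => exact ih.trans (hsn i _)
  have hwr : ∀ x y, G.Reachable x y → ∃ l, w l x = y := by
    intro x y hxy
    have := hxy.symm
    clear hxy
    obtain ⟨p⟩ := this
    induction p with
    | nil => exact ⟨[], rfl⟩
    | cons hadj' p ih =>
      obtain ⟨l, hl⟩ := ih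
      obtain ⟨i, hi⟩ := hh _ _ (show (_, _) ∈ {p : X × X | G.Adj p.1 p.2} from hadj'.symm)
      refine ⟨i :: l, ?_⟩
      change s i (w l _) = _
      rw [hl]
      simp only [s, hi, hadj'.symm, if_true]
  obtain ⟨e, he⟩ := exists_surjective_nat (List (Fin d))
  refine ⟨fun n => w (e n), embeddingReal X, ⟨fun n => hwm _, fun x y hxy => ?_,
    fun n => ⟨_, hwn (e n)⟩, fun n => measurableSet_setOfPred.1 (hadj _ (hwm _)),
    (measurableEmbedding_embeddingReal X).measurable,
    (measurableEmbedding_embeddingReal X).injective,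
    fun x => Set.finite_of_encard_le_coe (hdeg x)⟩⟩
  obtain ⟨l, hl⟩ := hwr x y hxy
  obtain ⟨n, rfl⟩ := he l
  exact ⟨n, hl⟩

end Borel

/-- The σ-algebra of sets that are measurable outside of `Z`. -/
abbrev measurableOff {X : Type*} (m : MeasurableSpace X) {Z : Set X} (hZ : MeasurableSet[m] Z) :
    MeasurableSpace X where
  MeasurableSet' S := MeasurableSet[m] (S \ Z)
  measurableSet_empty := by rw [Set.empty_sdiff]; exact MeasurableSet.empty
  measurableSet_compl S hS := by
    have : Sᶜ \ Z = (S \ Z)ᶜ \ Z := by ext x; simp; tauto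
    rw [this]
    exact hS.compl.diff hZ
  measurableSet_iUnion f hf := by
    rw [Set.iUnion_sdiff]
    exact MeasurableSet.iUnion hf

section Category

variable {X : Type*} {G : SimpleGraph X} {g : ℕ → X → X} {φ : X → ℝ}

lemma Sys.off {m : MeasurableSpace X} (hs : Sys G g φ) {Z : Set X} (hZ : MeasurableSet Z)
    (hinv : ∀ x y, G.Reachable x y → x ∈ Z → y ∈ Z) : @Sys X (measurableOff m hZ) G g φ := by
  refine @Sys.mk X (measurableOff m hZ) G g φ (fun n S hS => ?_) hs.reach hs.len
    (fun n S hS => ?_) (fun S hS => ?_) hs.inj_φ hs.fin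
  · have : g n ⁻¹' S \ Z = g n ⁻¹' (S \ Z) \ Z := by
      ext x
      simp only [Set.mem_sdiff, Set.mem_preimage]
      refine ⟨fun h => ⟨⟨h.1, fun h' => h.2 (hinv _ _ (hs.reachable n x).symm h')⟩, h.2⟩,
        fun h => ⟨h.1.1, h.2⟩⟩
    change MeasurableSet[m] (_ \ Z)
    rw [this]
    exact (hs.meas_g n hS).diff hZ
  · exact (hs.meas_adj n hS).diff hZ
  · exact (hs.meas_φ hS).diff hZ

/-- Every measurable system is covered by sparse sets off a meager invariant set. -/
lemma Sys.exists_cover_off [TopologicalSpace X] [PolishSpace X] [MeasurableSpace X] [BorelSpace X]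
    (hs : Sys G g φ) (r : ℕ → ℕ) : ∃ (V : ℕ → Set X) (Z : Set X), (∀ n, MeasurableSet (V n)) ∧
      MeasurableSet Z ∧ IsMeagre Z ∧ (∀ x y, G.Reachable x y → x ∈ Z → y ∈ Z) ∧
      (∀ n, Discrete G (r n) (V n)) ∧ Zᶜ ⊆ ⋃ n, V n := by
  choose V hVm hVd hVu using fun k => hs.exists_discrete_cover (r k)
  by_cases hX : Nonempty X
  swap
  · exact ⟨fun _ => ∅, ∅, fun _ => MeasurableSet.empty, MeasurableSet.empty, IsMeagre.empty,
      fun _ _ _ h => h, fun _ _ h => absurd h (Set.notMem_empty _),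
      fun x => absurd ⟨x⟩ hX⟩
  obtain ⟨O, hO⟩ := (TopologicalSpace.countable_countableBasis X).exists_eq_range
    (((TopologicalSpace.isBasis_countableBasis X).exists_subset_of_mem_open
      (Set.mem_univ hX.some) isOpen_univ).imp fun _ h => h.1)
  have hOo : ∀ i, IsOpen (O i) := fun i =>
    TopologicalSpace.isOpen_of_mem_countableBasis (hO ▸ ⟨i, rfl⟩)
  have hn : ∀ k : ℕ, ∃ n, (O k.unpair.2).Nonempty →
      ¬ IsMeagre (O k.unpair.2 ∩ g k.unpair.1 ⁻¹' V k n) := by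
    intro k
    by_cases hne : (O k.unpair.2).Nonempty
    · by_contra! hcon
      refine not_isMeagre_of_isOpen (hOo _) hne (IsMeagre.mono ?_
        (isMeagre_iUnion fun n => (hcon n).2))
      intro x hx
      obtain ⟨n, hn⟩ := Set.mem_iUnion.1 (hVu k ▸ Set.mem_univ (g k.unpair.1 x))
      exact Set.mem_iUnion.2 ⟨n, hx, hn⟩
    · exact ⟨0, fun h => absurd h hne⟩
  choose n hn using hn
  have hZm : ∀ m, MeasurableSet (g m ⁻¹' ⋂ k, (V k (n k))ᶜ) := fun m =>
    hs.meas_g m (MeasurableSet.iInter fun k => (hVm k (n k)).compl)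
  have hZmeagre : ∀ m, IsMeagre (g m ⁻¹' ⋂ k, (V k (n k))ᶜ) := by
    intro m
    obtain ⟨u, hu, hZu⟩ := (hZm m).residualEq_isOpen
    rcases u.eq_empty_or_nonempty with rfl | ⟨x, hx⟩
    · filter_upwards [hZu] with x hx h
      exact (hx.mp h).elim
    · obtain ⟨o, ho, hxo, hou⟩ :=
        (TopologicalSpace.isBasis_countableBasis X).exists_subset_of_mem_open hx hu
      rw [hO] at ho
      obtain ⟨i, rfl⟩ := ho
      have hk := hn (Nat.pair m i)
      simp only [Nat.unpair_pair] at hk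
      refine absurd ?_ (hk ⟨x, hxo⟩)
      filter_upwards [hZu] with y hy hyO
      exact Set.mem_iInter.1 (hy.mpr (hou hyO.1)) _ hyO.2
  refine ⟨fun k => V k (n k), ⋃ m, g m ⁻¹' ⋂ k, (V k (n k))ᶜ, fun k => hVm _ _,
    MeasurableSet.iUnion hZm, isMeagre_iUnion hZmeagre, fun x y hxy hx => ?_, fun k => hVd _ _,
    fun x hx => ?_⟩
  · obtain ⟨m, hm⟩ := Set.mem_iUnion.1 hx
    obtain ⟨m', hm'⟩ := hs.reach _ _ (hxy.symm.trans (hs.reachable m x))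
    refine Set.mem_iUnion.2 ⟨m', ?_⟩
    rw [Set.mem_preimage, hm']
    exact hm
  · obtain ⟨m, hm⟩ := hs.reach x x (SimpleGraph.Reachable.refl x)
    by_contra hc
    refine hx (Set.mem_iUnion.2 ⟨m, ?_⟩)
    rw [Set.mem_preimage, hm]
    exact Set.mem_iInter.2 fun k hk => hc (Set.mem_iUnion.2 ⟨k, hk⟩)

/-- Brooks's theorem with Baire measurable colorings for measurable systems. -/
theorem Sys.baire_brooks [TopologicalSpace X] [PolishSpace X] [m : MeasurableSpace X]
    [BorelSpace X] (hs : Sys G g φ) {d : ℕ} (hd : 3 ≤ d)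
    (hdeg : ∀ x, (G.neighborSet x).ncard ≤ d) (hfree : G.CliqueFree (d + 1)) :
    ∃ c : X → Fin d, (∀ s : Set (Fin d), BaireMeasurableSet (c ⁻¹' s)) ∧
      ∀ x y, G.Adj x y → c x ≠ c y := by
  obtain ⟨V, Z, hV, hZ, hZmeagre, hZinv, hVd, hVu⟩ :=
    hs.exists_cover_off fun n => 4 * scale n + 10
  let rep : X → X := fun x => (G.connectedComponentMk x).out
  have hrep : ∀ x, G.Reachable (rep x) x := fun x =>
    SimpleGraph.ConnectedComponent.exact (Quot.out_eq _)
  have hrep' : ∀ x y, G.Reachable x y → rep x = rep y := fun x y hxy =>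
    congrArg Quot.out (SimpleGraph.ConnectedComponent.sound hxy)
  obtain ⟨c, hc, hc'⟩ := @Sys.brooks X G d (measurableOff m hZ) g φ (hs.off hZ hZinv) hd
    hdeg hfree (fun n => V n \ Z ∪ {x | x ∈ Z ∧ g n (rep x) = x}) (fun n => by
      have : (V n \ Z ∪ {x | x ∈ Z ∧ g n (rep x) = x}) \ Z = V n \ Z := by
        ext x
        simp only [Set.mem_sdiff, Set.mem_union, Set.mem_ofPred_eq]
        tauto
      change MeasurableSet[m] (_ \ Z)
      rw [this]
      exact (hV n).diff hZ)
    (fun n x hx y hy hxy => by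
      rcases hx with hx | hx <;> rcases hy with hy | hy
      · exact hVd n x hx.1 y hy.1 hxy
      · exact absurd (hZinv _ _ hxy.reachable.symm hy.1) hx.2
      · exact absurd (hZinv _ _ hxy.reachable hx.1) hy.2
      · rw [← hx.2, ← hy.2, hrep' _ _ hxy.reachable])
    (Set.eq_univ_of_forall fun x => Set.mem_iUnion.2 (by
      by_cases hx : x ∈ Z
      · obtain ⟨n, hn⟩ := hs.reach _ _ (hrep x)
        exact ⟨n, Or.inr ⟨hx, hn⟩⟩
      · obtain ⟨n, hn⟩ := Set.mem_iUnion.1 (hVu hx)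
        exact ⟨n, Or.inl ⟨hn, hx⟩⟩))
  refine ⟨c, fun s => ?_, hc'⟩
  have h1 : MeasurableSet[m] (c ⁻¹' s \ Z) := hc trivial
  refine h1.baireMeasurableSet.congr ?_
  rw [Filter.eventuallyEq_set]
  filter_upwards [hZmeagre] with x hx
  exact ⟨fun h => h.1, fun h => ⟨h, hx⟩⟩

end Category

end BaireBrooks


theorem stmt_1 {X : Type*} [mX : MeasurableSpace X] [StandardBorelSpace X]
    (G : SimpleGraph X) (hGmeas : MeasurableSet {p : X × X | G.Adj p.1 p.2})
    (d : ℕ) (hd : 3 ≤ d)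
    (hdeg : ∀ x : X, (G.neighborSet x).encard ≤ (d : ℕ∞))
    (hclique : G.CliqueFree (d + 1))
    (τ : TopologicalSpace X) (hpolish : @PolishSpace X τ)
    (hcompat : @borel X τ = mX) :
    ∃ c : X → Fin d, (∀ s : Set (Fin d), @BaireMeasurableSet X τ (c ⁻¹' s)) ∧
      ∀ x y : X, G.Adj x y → c x ≠ c y := by
  obtain ⟨g, φ, hs⟩ := BaireBrooks.exists_sys hGmeas hdeg
  have : BorelSpace X := ⟨hcompat.symm⟩
  exact hs.baire_brooks hd (fun x => ENat.natCast_le_natCast.1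
    ((Set.Finite.cast_ncard_eq (hs.fin x)).trans_le (hdeg x))) hclique
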